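/- arXiv:1011.6355 — 2 statements merged into one kernel-verified Lean document; each statement's English description precedes it below -/
import Mathlib

section
/- Let T be a nonnegative random variable, independent of the process {X(t)}, whose tail distribution is slowly varying, i.e. P(T > t) = L(t) with L(·) slowly varying at ∞. Then, as u → ∞, P(sup_{s ∈ [0,T]} X(s) > u) = L(u^{(α−2)/α} exp(u²/2)) · (1 + o(1)). -/
open MeasureTheory ProbabilityTheory Filter Set Topology


/-- Standard Gaussian tail. -/
noncomputable def Psi (x : ℝ) : ℝ := (gaussianReal 0 1).real (Ioi x)

lemma Psi_eq (x : ℝ) : Psi x = ∫ y in Ioi x, gaussianPDFReal 0 1 y := by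
  unfold Psi
  rw [Measure.real, gaussianReal_apply_eq_integral 0 one_ne_zero,
    ENNReal.toReal_ofReal]
  exact setIntegral_nonneg measurableSet_Ioi fun y _ => gaussianPDFReal_nonneg _ _ _

lemma pdf_eq (y : ℝ) : gaussianPDFReal 0 1 y = (√(2 * Real.pi))⁻¹ * Real.exp (-y ^ 2 / 2) := by
  simp [gaussianPDFReal]

lemma sqrt_two_pi_ge : 1 ≤ √(2 * Real.pi) := by
  rw [Real.one_le_sqrt]; linarith [Real.pi_gt_three]

lemma sqrt_two_pi_le : √(2 * Real.pi) ≤ 3 := by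
  rw [Real.sqrt_le_iff]; constructor
  · norm_num
  · linarith [Real.pi_lt_four]

lemma pdf_le (y : ℝ) : gaussianPDFReal 0 1 y ≤ Real.exp (-y ^ 2 / 2) := by
  rw [pdf_eq]
  have : (√(2 * Real.pi))⁻¹ ≤ 1 := inv_le_one_of_one_le₀ sqrt_two_pi_ge
  nlinarith [Real.exp_pos (-y ^ 2 / 2)]

lemma pdf_ge (y : ℝ) : Real.exp (-y ^ 2 / 2) / 3 ≤ gaussianPDFReal 0 1 y := by
  rw [pdf_eq]
  have : (3:ℝ)⁻¹ ≤ (√(2 * Real.pi))⁻¹ :=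
    inv_anti₀ (lt_of_lt_of_le one_pos sqrt_two_pi_ge) sqrt_two_pi_le
  rw [div_eq_inv_mul]
  exact mul_le_mul_of_nonneg_right this (Real.exp_pos _).le

lemma Psi_nonneg (x : ℝ) : 0 ≤ Psi x := measureReal_nonneg

lemma Psi_anti {x y : ℝ} (h : x ≤ y) : Psi y ≤ Psi x :=
  measureReal_mono (Ioi_subset_Ioi h)

lemma integral_tail (x : ℝ) :
    IntegrableOn (fun y : ℝ => y * Real.exp (-y ^ 2 / 2)) (Ioi x) ∧
    ∫ y in Ioi x, y * Real.exp (-y ^ 2 / 2) = Real.exp (-x ^ 2 / 2) := by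
  have hintg : Integrable (fun y : ℝ => y * Real.exp (-y ^ 2 / 2)) := by
    have := integrable_mul_exp_neg_mul_sq (b := 1/2) (by norm_num)
    refine this.congr (ae_of_all _ fun y => ?_)
    simp only
    congr 2; ring
  refine ⟨hintg.integrableOn, ?_⟩
  have hd : ∀ y ∈ Ici x, HasDerivAt (fun y : ℝ => -Real.exp (-y ^ 2 / 2))
      (y * Real.exp (-y ^ 2 / 2)) y := by
    intro y _
    have h1 : HasDerivAt (fun y : ℝ => -y ^ 2 / 2) (-y) y := by
      have := ((hasDerivAt_pow 2 y).neg).div_const 2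
      exact this.congr_deriv (by norm_num; ring)
    exact h1.exp.neg.congr_deriv (by ring)
  have ht : Tendsto (fun y : ℝ => -Real.exp (-y ^ 2 / 2)) atTop (𝓝 0) := by
    have : Tendsto (fun y : ℝ => -y ^ 2 / 2) atTop atBot := by
      have h2 : Tendsto (fun y : ℝ => y ^ 2 / 2) atTop atTop :=
        (tendsto_pow_atTop two_ne_zero).atTop_div_const (by norm_num)
      have := tendsto_neg_atTop_atBot.comp h2
      refine this.congr fun y => ?_
      simp; ring
    simpa using (Real.tendsto_exp_atBot.comp this).neg
  have := integral_Ioi_of_hasDerivAt_of_tendsto' hd hintg.integrableOn ht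
  rw [this]; ring

lemma Psi_le {x : ℝ} (hx : 0 < x) : Psi x ≤ Real.exp (-x ^ 2 / 2) / x := by
  obtain ⟨h1, h2⟩ := integral_tail x
  rw [Psi_eq, ← h2, ← integral_div]
  refine setIntegral_mono_on (integrable_gaussianPDFReal 0 1).integrableOn (h1.div_const x)
    measurableSet_Ioi fun y hy => (pdf_le y).trans ?_
  rw [mul_div_right_comm]
  have : 1 ≤ y / x := by rw [le_div_iff₀ hx]; simpa using (le_of_lt hy)
  nlinarith [Real.exp_pos (-y ^ 2 / 2)]

lemma Psi_ge {x : ℝ} (hx : 1 ≤ x) : Real.exp (-x ^ 2 / 2) / x / 30 ≤ Psi x := by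
  have hx0 : 0 < x := by linarith
  have hle : x ≤ x + 1 / x := by have := one_div_pos.2 hx0; linarith
  rw [Psi_eq]
  have hi := integrable_gaussianPDFReal 0 1
  calc Real.exp (-x ^ 2 / 2) / x / 30
      ≤ ∫ y in Ioc x (x + 1 / x), Real.exp (-x ^ 2 / 2) / 30 := by
        rw [setIntegral_const]
        simp only [Measure.real, Real.volume_Ioc, smul_eq_mul]
        rw [ENNReal.toReal_ofReal (by linarith)]
        apply le_of_eq; field_simp; ring
    _ ≤ ∫ y in Ioc x (x + 1 / x), gaussianPDFReal 0 1 y := by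
        refine setIntegral_mono_on (by simp) hi.integrableOn
          measurableSet_Ioc fun y hy => le_trans ?_ (pdf_ge y)
        have h3 : Real.exp (-x ^ 2 / 2) * Real.exp (-2) ≤ Real.exp (-y ^ 2 / 2) := by
          rw [← Real.exp_add]
          apply Real.exp_le_exp.2
          have h4 : y ^ 2 ≤ (x + 1 / x) ^ 2 := pow_le_pow_left₀ (by linarith [hy.1]) hy.2 2
          have h5 : (x + 1 / x) ^ 2 = x ^ 2 + 2 + (1 / x) ^ 2 := by field_simp; ring
          have h6 : 1 / x ≤ 1 := by rw [div_le_one hx0]; exact hx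
          have h7 : (1 / x) ^ 2 ≤ 1 := pow_le_one₀ (by positivity) h6
          linarith
        have h8 : (1:ℝ)/10 ≤ Real.exp (-2) := by
          have : Real.exp 2 ≤ 10 := by
            have : Real.exp 2 = Real.exp 1 ^ 2 := by rw [← Real.exp_nat_mul]; norm_num
            rw [this]
            have := Real.exp_one_lt_d9
            nlinarith [Real.exp_pos 1]
          rw [Real.exp_neg, one_div]
          exact inv_anti₀ (Real.exp_pos _) this
        nlinarith [Real.exp_pos (-x ^ 2 / 2)]
    _ ≤ _ := setIntegral_mono_set hi.integrableOn
        (ae_of_all _ fun y => gaussianPDFReal_nonneg _ _ _) (Ioc_subset_Ioi_self).eventuallyLE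

lemma Psi_pos {x : ℝ} (hx : 1 ≤ x) : 0 < Psi x := by
  refine lt_of_lt_of_le ?_ (Psi_ge hx)
  have : 0 < x := by linarith
  positivity

lemma Psi_shift {u h : ℝ} (h0 : 0 ≤ h) (hu : h ≤ u) :
    Psi (u - h) ≤ Psi u + h * Real.exp (-(u - h) ^ 2 / 2) := by
  have hi := integrable_gaussianPDFReal 0 1
  rw [Psi_eq, Psi_eq]
  have hun : Ioi (u - h) = Ioc (u - h) u ∪ Ioi u := (Ioc_union_Ioi_eq_Ioi (by linarith)).symm
  rw [hun, setIntegral_union (by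
    rw [Set.disjoint_left]; intro y hy hy2; exact absurd hy.2 (not_le.2 hy2)) measurableSet_Ioi
    hi.integrableOn hi.integrableOn, add_comm]
  gcongr
  calc ∫ y in Ioc (u - h) u, gaussianPDFReal 0 1 y
      ≤ ∫ y in Ioc (u - h) u, Real.exp (-(u - h) ^ 2 / 2) := by
        refine setIntegral_mono_on hi.integrableOn (by simp)
          measurableSet_Ioc fun y hy => (pdf_le y).trans ?_
        apply Real.exp_le_exp.2
        have : (u - h) ^ 2 ≤ y ^ 2 := pow_le_pow_left₀ (by linarith) hy.1.le 2
        linarith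
    _ = _ := by
        rw [setIntegral_const]
        simp only [Measure.real, Real.volume_Ioc, smul_eq_mul]
        rw [ENNReal.toReal_ofReal (by linarith)]; ring

lemma gauss_chernoff {v : NNReal} {w x : ℝ} (hw : 0 < w) (hv : (v:ℝ) ≤ w) (hx : 0 ≤ x) :
    (gaussianReal 0 v).real (Ici x) ≤ Real.exp (-x ^ 2 / (2 * w)) := by
  have h := measure_ge_le_exp_mul_mgf (μ := gaussianReal 0 v) (X := fun y => y) (t := x / w) x
    (by positivity) (integrable_exp_mul_gaussianReal _)
  have h2 : {ω : ℝ | x ≤ ω} = Ici x := rfl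
  rw [h2, mgf_fun_id_gaussianReal, ← Real.exp_add] at h
  refine h.trans (Real.exp_le_exp.2 ?_)
  have : (v:ℝ) * (x / w) ^ 2 / 2 ≤ w * (x / w) ^ 2 / 2 := by gcongr
  have e : w * (x / w) ^ 2 / 2 = x ^ 2 / (2 * w) := by field_simp
  have e2 : -(x / w) * x = - (2 * (x ^ 2 / (2 * w))) := by field_simp
  have e3 : -x ^ 2 / (2 * w) = - (x ^ 2 / (2 * w)) := by ring
  rw [e2, e3]; linarith

lemma gauss_chernoff' {v : NNReal} {w x : ℝ} (hw : 0 < w) (hv : (v:ℝ) ≤ w) (hx : 0 ≤ x) :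
    (gaussianReal 0 v).real (Iic (-x)) ≤ Real.exp (-x ^ 2 / (2 * w)) := by
  refine le_trans (le_of_eq ?_) (gauss_chernoff hw hv hx)
  have h : (gaussianReal 0 v).map (fun x => -x) = gaussianReal 0 v := by
    rw [gaussianReal_map_neg]; simp
  conv_rhs => rw [← h]
  rw [map_measureReal_apply measurable_neg measurableSet_Ici]
  congr 1; ext y; simp


/-- Finite dimensional laws of the process. -/
def GP {Ω : Type*} [MeasurableSpace Ω] (P : Measure Ω) (X : ℝ → Ω → ℝ) (r : ℝ → ℝ) : Prop :=
  ∀ (n : ℕ) (c : Fin n → ℝ) (t : Fin n → ℝ), (∀ i, 0 ≤ t i) →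
      Measure.map (fun ω => ∑ i, c i * X (t i) ω) P
        = gaussianReal 0 (Real.toNNReal (∑ i, ∑ j, c i * c j * r (|t i - t j|)))

set_option linter.unusedSectionVars false
section B
variable {Ω : Type*} [MeasurableSpace Ω] {P : Measure Ω} [IsProbabilityMeasure P]
  {X : ℝ → Ω → ℝ} {r : ℝ → ℝ}

lemma GP.one (hG : GP P X r) {s : ℝ} (hs : 0 ≤ s) :
    P.map (X s) = gaussianReal 0 (Real.toNNReal (r 0)) := by
  have := hG 1 (fun _ => 1) (fun _ => s) (fun _ => hs)
  simpa using this

lemma GP.two (hG : GP P X r) {s t : ℝ} (hs : 0 ≤ s) (ht : 0 ≤ t) (a b : ℝ) :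
    P.map (fun ω => a * X s ω + b * X t ω) =
      gaussianReal 0 (Real.toNNReal ((a ^ 2 + b ^ 2) * r 0 + 2 * a * b * r |s - t|)) := by
  have := hG 2 ![a, b] ![s, t] (by intro i; fin_cases i <;> simp [hs, ht])
  simp only [Fin.sum_univ_two, Matrix.cons_val_zero, Matrix.cons_val_one, sub_self, abs_zero] at this
  rw [this, abs_sub_comm t s]
  congr 2; ring

lemma aem_of_map {Y : Ω → ℝ} {v : NNReal} (h : P.map Y = gaussianReal 0 v) : AEMeasurable Y P := by
  by_contra hc
  rw [Measure.map_of_not_aemeasurable hc] at h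
  exact (IsProbabilityMeasure.ne_zero (gaussianReal 0 v)) h.symm

lemma GP.aem (hG : GP P X r) {s : ℝ} (hs : 0 ≤ s) : AEMeasurable (X s) P := aem_of_map (hG.one hs)

lemma char_of_map {Y : Ω → ℝ} {v : NNReal} (h : P.map Y = gaussianReal 0 v) :
    ∫ ω, Complex.exp (Y ω * Complex.I) ∂P = ((Real.exp (-(v:ℝ) / 2) : ℝ) : ℂ) := by
  have h1 := charFun_gaussianReal (μ := 0) (v := v) 1
  rw [← h, charFun_apply_real, integral_map (aem_of_map h) (by fun_prop)] at h1
  simp only [Complex.ofReal_one, one_mul] at h1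
  rw [h1]; push_cast; congr 1; simp; ring

lemma GP.V_cont (hG : GP P X r) (hcont : ∀ᵐ ω ∂P, ContinuousOn (fun t => X t ω) (Ici 0)) :
    ContinuousOn (fun t => max (2 * r 0 + 2 * r t) 0) (Ici 0) := by
  have hV : ∀ t, 0 ≤ t → ∫ ω, Complex.exp (((X 0 ω + X t ω : ℝ) : ℂ) * Complex.I) ∂P =
      ((Real.exp (-(max (2 * r 0 + 2 * r t) 0) / 2) : ℝ) : ℂ) := by
    intro t ht
    have h2 := hG.two le_rfl ht 1 1
    simp only [one_mul, zero_sub, abs_neg, abs_of_nonneg ht] at h2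
    rw [char_of_map h2, Real.coe_toNNReal']
    norm_num
  intro t ht
  have hlim : Tendsto (fun t => ∫ ω, Complex.exp (((X 0 ω + X t ω : ℝ) : ℂ) * Complex.I) ∂P)
      (𝓝[Ici 0] t) (𝓝 (∫ ω, Complex.exp (((X 0 ω + X t ω : ℝ) : ℂ) * Complex.I) ∂P)) := by
    refine tendsto_integral_filter_of_dominated_convergence (fun _ => 1) ?_ ?_ (by simp) ?_
    · filter_upwards [self_mem_nhdsWithin] with s hs
      have h1 := hG.aem (le_refl (0:ℝ))
      have h2 := hG.aem hs
      exact (Complex.measurable_exp.comp_aemeasurable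
        ((Complex.measurable_ofReal.comp_aemeasurable (h1.add h2)).mul_const _)).aestronglyMeasurable
    · exact Eventually.of_forall fun s => ae_of_all _ fun ω => by
        rw [Complex.norm_exp_ofReal_mul_I]
    · filter_upwards [hcont] with ω hω
      have h1 : Tendsto (fun s => X s ω) (𝓝[Ici 0] t) (𝓝 (X t ω)) := hω t ht
      have h2 : Continuous fun x : ℝ => Complex.exp (((X 0 ω + x : ℝ) : ℂ) * Complex.I) := by
        fun_prop
      exact (h2.tendsto _).comp h1
  have hlim2 : Tendsto (fun t => Real.exp (-(max (2 * r 0 + 2 * r t) 0) / 2)) (𝓝[Ici 0] t)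
      (𝓝 (Real.exp (-(max (2 * r 0 + 2 * r t) 0) / 2))) := by
    rw [hV t ht] at hlim
    have h3 := (Complex.continuous_re.tendsto _).comp hlim
    rw [Complex.ofReal_re] at h3
    refine h3.congr' ?_
    filter_upwards [self_mem_nhdsWithin] with s hs
    simp only [Function.comp]
    rw [hV s hs, Complex.ofReal_re]
  have h4 := ((Real.continuousAt_log (Real.exp_pos _).ne').tendsto.comp hlim2).const_mul (-2)
  simp only [Function.comp_def, Real.log_exp] at h4
  show Tendsto _ _ _
  refine (h4.congr fun s => ?_).trans ?_
  · ring
  · apply le_of_eq; congr 1; ring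

lemma GP.r0_pos (hG : GP P X r) (hr : Tendsto r (𝓝[>] 0) (𝓝 1)) : 0 < r 0 := by
  by_contra hneg
  push Not at hneg
  have h0 : ∀ s, 0 ≤ s → ∀ᵐ ω ∂P, X s ω = 0 := by
    intro s hs
    have h1 := hG.one hs
    rw [Real.toNNReal_of_nonpos hneg, gaussianReal_zero_var] at h1
    have h2 : ∀ᵐ x ∂(P.map (X s)), x = 0 := by
      rw [h1]; exact (ae_dirac_iff (measurableSet_singleton (0:ℝ))).2 rfl
    exact ae_of_ae_map (hG.aem hs) h2
  have h5 : ∀ᶠ t in 𝓝[>] (0:ℝ), 1 / 2 < r t := hr.eventually (lt_mem_nhds (by norm_num))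
  obtain ⟨δ, hδ, hδ2⟩ := mem_nhdsGT_iff_exists_Ioo_subset.1 h5
  obtain ⟨n, hn⟩ := exists_nat_gt (1 - 2 * r 0)
  have hn0 : (0:ℝ) < n := by linarith
  have hδ0 : (0:ℝ) < δ := hδ
  set h := δ / (n + 1) with hh
  have hhpos : 0 < h := by positivity
  have hmap := hG n (fun _ => 1) (fun i => (i:ℕ) * h) (fun i => by positivity)
  have hz : (fun ω => ∑ i : Fin n, (1:ℝ) * X ((i:ℕ) * h) ω) =ᵐ[P] fun _ => (0:ℝ) := by
    have : ∀ᵐ ω ∂P, ∀ i : Fin n, X ((i:ℕ) * h) ω = 0 := by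
      rw [ae_all_iff]; intro i; exact h0 _ (by positivity)
    filter_upwards [this] with ω hω
    simp [hω]
  rw [Measure.map_congr hz, Measure.map_const, measure_univ, one_smul,
    ← gaussianReal_zero_var, gaussianReal_ext_iff] at hmap
  have hle := Real.toNNReal_eq_zero.1 hmap.2.symm
  have key : ∀ i : Fin n, (n - 1) * (1/2) + r 0 ≤ ∑ j : Fin n, (1:ℝ) * 1 * r |(i:ℕ) * h - (j:ℕ) * h| := by
    intro i
    rw [← Finset.add_sum_erase _ _ (Finset.mem_univ i), add_comm]
    gcongr
    · simp
    · have : ((n:ℝ) - 1) * (1/2) = ∑ j ∈ Finset.univ.erase i, (1/2 : ℝ) := by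
        rw [Finset.sum_const, Finset.card_erase_of_mem (Finset.mem_univ i), nsmul_eq_mul]
        have : 1 ≤ n := by exact_mod_cast hn0
        simp [Nat.cast_sub this]
      rw [this]
      refine Finset.sum_le_sum fun j hj => ?_
      rw [one_mul, one_mul]
      refine le_of_lt (hδ2 ⟨?_, ?_⟩)
      · rw [abs_pos, ← sub_mul]
        refine mul_ne_zero (sub_ne_zero.2 ?_) hhpos.ne'
        intro he
        exact (Finset.ne_of_mem_erase hj) (Fin.ext (by exact_mod_cast he.symm))
      · rw [← sub_mul, abs_mul, abs_of_pos hhpos]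
        have hi : ((i:ℕ):ℝ) < n := by exact_mod_cast i.2
        have hj : ((j:ℕ):ℝ) < n := by exact_mod_cast j.2
        have : |((i:ℕ):ℝ) - (j:ℕ)| < n + 1 := by
          rw [abs_lt]; constructor <;> linarith [(Nat.cast_nonneg (i:ℕ) : (0:ℝ) ≤ (i:ℕ)), (Nat.cast_nonneg (j:ℕ) : (0:ℝ) ≤ (j:ℕ))]
        calc |((i:ℕ):ℝ) - (j:ℕ)| * h < (n + 1) * h := by gcongr
          _ = δ := by rw [hh]; field_simp
  have hsum := Finset.sum_le_sum (fun i (_ : i ∈ Finset.univ) => key i)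
  rw [Finset.sum_const, Finset.card_univ, Fintype.card_fin, nsmul_eq_mul] at hsum
  have : 0 < (n:ℝ) * ((n - 1) * (1/2) + r 0) := by
    apply mul_pos hn0; linarith
  exact absurd (hsum.trans hle) (not_le.2 this)

lemma GP.r0 (hG : GP P X r) (hcont : ∀ᵐ ω ∂P, ContinuousOn (fun t => X t ω) (Ici 0))
    (hr : Tendsto r (𝓝[>] 0) (𝓝 1)) : r 0 = 1 := by
  have hpos := hG.r0_pos hr
  have h1 : Tendsto (fun t => max (2 * r 0 + 2 * r t) 0) (𝓝[Ici 0] 0) _ :=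
    hG.V_cont hcont 0 (by simp)
  have h2 := h1.mono_left (nhdsWithin_mono 0 Ioi_subset_Ici_self)
  have h3 : Tendsto (fun t => max (2 * r 0 + 2 * r t) 0) (𝓝[>] 0) (𝓝 (max (2 * r 0 + 2 * 1) 0)) :=
    ((hr.const_mul 2).const_add _).max tendsto_const_nhds
  have h4 := tendsto_nhds_unique h2 h3
  simp only at h4
  rw [max_eq_left (by linarith), max_eq_left (by linarith)] at h4
  linarith

lemma GP.r_bound (hG : GP P X r) (hcont : ∀ᵐ ω ∂P, ContinuousOn (fun t => X t ω) (Ici 0))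
    (hr0 : r 0 = 1) (hA2 : ∀ t : ℝ, 0 < t → r t < 1) (hinf : Tendsto r atTop (𝓝 0))
    {δ : ℝ} (hδ : 0 < δ) : ∃ ρ, 0 < ρ ∧ ρ < 1 ∧ ∀ t, δ ≤ t → r t ≤ ρ := by
  obtain ⟨M, hM⟩ := eventually_atTop.1 (hinf.eventually (gt_mem_nhds (show (0:ℝ) < 1/2 by norm_num)))
  have hc : ContinuousOn (fun t => max (2 * r 0 + 2 * r t) 0) (Icc δ (max δ M)) :=
    (hG.V_cont hcont).mono fun t ht => hδ.le.trans ht.1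
  obtain ⟨x, hx, hmax⟩ := isCompact_Icc.exists_isMaxOn ⟨δ, by simp⟩ hc
  refine ⟨max (1/2) (max (2 * r 0 + 2 * r x) 0 / 2 - 1), by positivity, ?_, ?_⟩
  · refine max_lt (by norm_num) ?_
    have := hA2 x (hδ.trans_le hx.1)
    have : max (2 * r 0 + 2 * r x) 0 < 4 := max_lt (by linarith) (by norm_num)
    linarith
  · intro t ht
    by_cases h : t ≤ max δ M
    · have h2 := hmax ⟨ht, h⟩
      simp only [mem_ofPred_eq] at h2
      refine le_trans ?_ (le_max_right _ _)
      have := le_max_left (2 * r 0 + 2 * r t) 0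
      linarith
    · push Not at h
      exact (hM t ((le_max_right _ _).trans h.le)).le.trans (le_max_left _ _)

lemma GP.tail (hG : GP P X r) (hr0 : r 0 = 1) {s : ℝ} (hs : 0 ≤ s) (u : ℝ) :
    P.real {ω | u < X s ω} = Psi u := by
  have h := hG.one hs
  rw [hr0, Real.toNNReal_one] at h
  unfold Psi
  rw [← h, map_measureReal_apply_of_aemeasurable (hG.aem hs) measurableSet_Ioi]
  rfl

/-- Two exceedances, crude bound. -/
lemma GP.pair_le (hG : GP P X r) (hr0 : r 0 = 1) {s t : ℝ} (hs : 0 ≤ s) (ht : 0 ≤ t) {u ρ : ℝ}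
    (hu : 0 ≤ u) (hρ0 : 0 ≤ ρ) (hρ : r |s - t| ≤ ρ) :
    P.real ({ω | u < X s ω} ∩ {ω | u < X t ω}) ≤ Real.exp (-u ^ 2 / (1 + ρ)) := by
  have h2 := hG.two hs ht 1 1
  have hm := aem_of_map h2
  calc P.real ({ω | u < X s ω} ∩ {ω | u < X t ω})
      ≤ P.real ((fun ω => 1 * X s ω + 1 * X t ω) ⁻¹' Ici (2 * u)) := by
        refine measureReal_mono ?_
        rintro ω ⟨h3, h4⟩
        simp only [mem_ofPred_eq] at h3 h4
        simp only [mem_preimage, mem_Ici]; linarith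
    _ = (gaussianReal 0 (Real.toNNReal ((1 ^ 2 + 1 ^ 2) * r 0 + 2 * 1 * 1 * r |s - t|))).real
          (Ici (2 * u)) := by
        rw [← h2, map_measureReal_apply_of_aemeasurable hm measurableSet_Ici]
    _ ≤ Real.exp (-(2 * u) ^ 2 / (2 * (2 * (1 + ρ)))) := by
        refine gauss_chernoff (by positivity) ?_ (by positivity)
        rw [Real.coe_toNNReal', hr0]
        apply max_le <;> linarith
    _ = _ := by congr 1; field_simp

/-- Two exceedances, sharp bound used for close times. -/
lemma GP.pair_le_near (hG : GP P X r) (hr0 : r 0 = 1) {s t : ℝ} (hs : 0 ≤ s) (ht : 0 ≤ t) {u : ℝ}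
    (hu : 0 < u) (h0 : 0 ≤ r |s - t|) (h1 : r |s - t| ≤ 1) :
    P.real ({ω | u < X s ω} ∩ {ω | u < X t ω}) ≤
      Real.exp (-u ^ 2 / 2) / u * Real.exp (-u ^ 2 * (1 - r |s - t|) / 4) := by
  set ρ := r |s - t| with hρ
  set c := (√(2 * (1 + ρ)))⁻¹ with hc
  have hs0 : 0 < √(2 * (1 + ρ)) := Real.sqrt_pos.2 (by linarith)
  have hcpos : 0 < c := inv_pos.2 hs0
  have hcsq : c ^ 2 = (2 * (1 + ρ))⁻¹ := by rw [hc, inv_pow, Real.sq_sqrt (by linarith)]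
  have h2 := hG.two hs ht c c
  rw [hr0, ← hρ] at h2
  have hv : (c ^ 2 + c ^ 2) * 1 + 2 * c * c * ρ = 1 := by
    have : (c ^ 2 + c ^ 2) * 1 + 2 * c * c * ρ = c ^ 2 * (2 * (1 + ρ)) := by ring
    rw [this, hcsq]; field_simp
  rw [hv, Real.toNNReal_one] at h2
  have hm := aem_of_map h2
  have hcu : (2 * c * u) ^ 2 = 2 * u ^ 2 / (1 + ρ) := by
    rw [mul_pow, mul_pow, hcsq]; field_simp
  have hcge : 1 ≤ 2 * c := by
    have : (1:ℝ) ^ 2 ≤ (2 * c) ^ 2 := by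
      rw [mul_pow, hcsq, one_pow, ← div_eq_mul_inv, le_div_iff₀ (by linarith)]; linarith
    exact le_of_sq_le_sq this (by positivity)
  calc P.real ({ω | u < X s ω} ∩ {ω | u < X t ω})
      ≤ P.real ((fun ω => c * X s ω + c * X t ω) ⁻¹' Ioi (2 * c * u)) := by
        refine measureReal_mono ?_
        rintro ω ⟨h3, h4⟩
        simp only [mem_ofPred_eq] at h3 h4
        simp only [mem_preimage, mem_Ioi]; nlinarith
    _ = Psi (2 * c * u) := by
        unfold Psi
        rw [← h2, map_measureReal_apply_of_aemeasurable hm measurableSet_Ioi]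
    _ ≤ Real.exp (-(2 * c * u) ^ 2 / 2) / (2 * c * u) := Psi_le (by positivity)
    _ ≤ Real.exp (-(2 * c * u) ^ 2 / 2) / u := by
        gcongr; nlinarith
    _ ≤ _ := by
        rw [div_mul_eq_mul_div, ← Real.exp_add]
        gcongr
        rw [hcu]
        have : u ^ 2 * (1 + (1 - ρ) / 2) ≤ 2 * u ^ 2 / (1 + ρ) := by
          rw [le_div_iff₀ (by linarith)]
          have : (1 + (1 - ρ) / 2) * (1 + ρ) ≤ 2 := by nlinarith
          nlinarith [sq_nonneg u]
        linarith

lemma GP.indep (hG : GP P X r) (hr0 : r 0 = 1) {s t : ℝ} (hs : 0 ≤ s) (ht : 0 ≤ t)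
    (hρ : (r |s - t|) ^ 2 ≤ 1) :
    IndepFun (X t) (fun ω => X s ω - r |s - t| * X t ω) P := by
  set ρ := r |s - t| with hρd
  have h1 := hG.one ht
  have h2 := hG.two hs ht 1 (-ρ)
  rw [hr0, ← hρd] at h2
  have e : (fun ω => 1 * X s ω + -ρ * X t ω) = fun ω => X s ω - ρ * X t ω := by ext ω; ring
  rw [e] at h2
  have hm1 := hG.aem ht
  have hm2 := aem_of_map h2
  rw [indepFun_iff_charFunDual_prod hm1 hm2]
  intro L
  set a := L (1, 0) with ha
  set b := L (0, 1) with hb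
  have hL : ∀ x y, L (x, y) = a * x + b * y := by
    intro x y
    have : ((x, y) : ℝ × ℝ) = x • (1, 0) + y • (0, 1) := by simp
    rw [this, map_add, map_smul, map_smul, smul_eq_mul, smul_eq_mul]; ring
  rw [charFunDual_apply, charFunDual_apply, charFunDual_apply,
    integral_map (hm1.prodMk hm2) (by fun_prop), integral_map hm1 (by fun_prop),
    integral_map hm2 (by fun_prop)]
  have i1 : ∫ ω, Complex.exp (L (X t ω, X s ω - ρ * X t ω) * Complex.I) ∂P =
      ((Real.exp (-(a ^ 2 + b ^ 2 * (1 - ρ ^ 2)) / 2) : ℝ) : ℂ) := by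
    have h3 := hG.two hs ht b (a - b * ρ)
    rw [hr0, ← hρd] at h3
    have e3 : (b ^ 2 + (a - b * ρ) ^ 2) * 1 + 2 * b * (a - b * ρ) * ρ = a ^ 2 + b ^ 2 * (1 - ρ ^ 2) := by
      ring
    rw [e3] at h3
    have := char_of_map h3
    rw [Real.coe_toNNReal _ (by nlinarith [sq_nonneg a, sq_nonneg b, mul_nonneg (sq_nonneg b) (sub_nonneg.2 hρ)])] at this
    rw [← this]
    congr 1; ext ω; rw [hL]; congr 3; ring
  have i2 : ∫ ω, Complex.exp ((L.comp (.inl ℝ ℝ ℝ)) (X t ω) * Complex.I) ∂P =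
      ((Real.exp (-(a ^ 2) / 2) : ℝ) : ℂ) := by
    have h3 := hG.two hs ht 0 a
    rw [hr0, ← hρd] at h3
    have := char_of_map h3
    rw [Real.coe_toNNReal _ (by nlinarith [sq_nonneg a])] at this
    have e5 : -((0 ^ 2 + a ^ 2) * 1 + 2 * 0 * a * ρ) / 2 = -(a ^ 2) / 2 := by ring
    rw [e5] at this
    rw [← this]
    congr 1; ext ω
    simp only [ContinuousLinearMap.comp_apply, ContinuousLinearMap.inl_apply]
    rw [hL]; congr 3; ring
  have i3 : ∫ ω, Complex.exp ((L.comp (.inr ℝ ℝ ℝ)) (X s ω - ρ * X t ω) * Complex.I) ∂P =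
      ((Real.exp (-(b ^ 2 * (1 - ρ ^ 2)) / 2) : ℝ) : ℂ) := by
    have h3 := hG.two hs ht b (- (b * ρ))
    rw [hr0, ← hρd] at h3
    have e3 : (b ^ 2 + (-(b * ρ)) ^ 2) * 1 + 2 * b * (-(b * ρ)) * ρ = b ^ 2 * (1 - ρ ^ 2) := by
      ring
    rw [e3] at h3
    have := char_of_map h3
    rw [Real.coe_toNNReal _ (mul_nonneg (sq_nonneg b) (sub_nonneg.2 hρ))] at this
    rw [← this]
    congr 1; ext ω
    simp only [ContinuousLinearMap.comp_apply, ContinuousLinearMap.inr_apply]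
    rw [hL]; congr 3; ring
  rw [i1, i2, i3, ← Complex.ofReal_mul, ← Real.exp_add]
  congr 2; ring

lemma GP.resid (hG : GP P X r) (hr0 : r 0 = 1) {s t : ℝ} (hs : 0 ≤ s) (ht : 0 ≤ t) :
    P.map (fun ω => X s ω - r |s - t| * X t ω) =
      gaussianReal 0 (Real.toNNReal (1 - (r |s - t|) ^ 2)) := by
  have h2 := hG.two hs ht 1 (-r |s - t|)
  rw [hr0] at h2
  have e : (fun ω => 1 * X s ω + -r |s - t| * X t ω) = fun ω => X s ω - r |s - t| * X t ω := by
    ext ω; ring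
  rw [e] at h2
  rw [h2]; congr 2; ring

lemma GP.indep_real (hG : GP P X r) (hr0 : r 0 = 1) {s t : ℝ} (hs : 0 ≤ s) (ht : 0 ≤ t)
    (hρ : (r |s - t|) ^ 2 ≤ 1) (a : ℝ) {B : Set ℝ} (hB : MeasurableSet B) :
    P.real ({ω | a < X t ω} ∩ {ω | X s ω - r |s - t| * X t ω ∈ B}) =
      Psi a * (gaussianReal 0 (Real.toNNReal (1 - (r |s - t|) ^ 2))).real B := by
  have h := (hG.indep hr0 hs ht hρ).measure_inter_preimage_eq_mul (Ioi a) B measurableSet_Ioi hB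
  rw [← hG.tail hr0 ht a, ← hG.resid hr0 hs ht,
    map_measureReal_apply_of_aemeasurable (aem_of_map (hG.resid hr0 hs ht)) hB]
  simp only [Measure.real]
  rw [← ENNReal.toReal_mul]
  exact congrArg _ h
end B


lemma gauss_small_var {v : NNReal} (hv : v ≤ 1) {z : ℝ} (hz : 0 ≤ z) :
    (gaussianReal 0 v).real (Ioi z) ≤ Psi z := by
  have h := gaussianReal_map_const_mul (μ := 0) (v := 1) (√(v:ℝ))
  have e : NNReal.mk ((√(v:ℝ)) ^ 2) (sq_nonneg _) * 1 = v := by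
    ext; simp
  rw [mul_zero, e] at h
  rw [← h, map_measureReal_apply (by fun_prop) measurableSet_Ioi]
  refine measureReal_mono ?_
  intro y hy
  simp only [mem_preimage, mem_Ioi] at hy ⊢
  have h1 : √(v:ℝ) ≤ 1 := Real.sqrt_le_one.2 (by exact_mod_cast hv)
  have h0 : 0 ≤ √(v:ℝ) := Real.sqrt_nonneg _
  have hy0 : 0 < y := by
    by_contra hc
    push Not at hc
    nlinarith [mul_nonneg h0 (neg_nonneg.2 hc)]
  nlinarith

set_option linter.unusedSectionVars false
section C
variable {Ω : Type*} [MeasurableSpace Ω] {P : Measure Ω} [IsProbabilityMeasure P]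
  {X : ℝ → Ω → ℝ} {r : ℝ → ℝ}

lemma GP.pair_far (hG : GP P X r) (hr0 : r 0 = 1) {s t : ℝ} (hs : 0 ≤ s) (ht : 0 ≤ t) {u : ℝ}
    (hu : 0 < u) {e : ℝ} (he : |r (|s - t|)| ≤ e) (he2 : e ≤ 1 / 4) :
    P.real ({ω | u < X s ω} ∩ {ω | u < X t ω}) ≤ Psi u * Psi (u - 2 * e * u) + Psi (2 * u) := by
  set ρ := r |s - t| with hρ
  have hρ1 : ρ ^ 2 ≤ 1 := by
    rw [← sq_abs]; exact pow_le_one₀ (abs_nonneg _) (by linarith)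
  have hsub : ({ω | u < X s ω} ∩ {ω | u < X t ω}) ⊆
      ({ω | u < X t ω} ∩ {ω | X s ω - ρ * X t ω ∈ Ioi (u - 2 * e * u)}) ∪ {ω | 2 * u < X t ω} := by
    rintro ω ⟨h1, h2⟩
    simp only [mem_ofPred_eq] at h1 h2
    by_cases h : 2 * u < X t ω
    · exact Or.inr h
    · left
      refine ⟨h2, ?_⟩
      push Not at h
      show u - 2 * e * u < X s ω - ρ * X t ω
      have : ρ * X t ω ≤ e * (2 * u) := by
        calc ρ * X t ω ≤ |ρ| * X t ω := by
              have := le_abs_self ρ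
              have : 0 < X t ω := hu.trans h2
              gcongr
          _ ≤ e * (2 * u) := by
              have := abs_nonneg ρ
              have : 0 < X t ω := hu.trans h2
              have : 0 ≤ e := by linarith [abs_nonneg ρ]
              gcongr
      linarith
  refine (measureReal_mono hsub).trans ((measureReal_union_le _ _).trans ?_)
  rw [hG.indep_real hr0 hs ht hρ1 u measurableSet_Ioi, hG.tail hr0 ht]
  have := Psi_nonneg u
  gcongr
  refine gauss_small_var ?_ ?_
  · rw [Real.toNNReal_le_iff_le_coe]; simp; positivity
  · nlinarith

lemma GP.chain_step (hG : GP P X r) (hr0 : r 0 = 1) {s t : ℝ} (hs : 0 ≤ s) (ht : 0 ≤ t)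
    (h0 : 0 ≤ r |s - t|) (h1 : r |s - t| ≤ 1) {η a b z : ℝ} (hη : 0 < η)
    (h2 : 1 - r |s - t| ≤ η) (hz : 0 ≤ z) (hab : b - r |s - t| * a ≤ - z) :
    P.real ({ω | a < X t ω} ∩ {ω | X s ω ≤ b}) ≤ Psi a * Real.exp (-z ^ 2 / (4 * η)) := by
  set ρ := r |s - t| with hρ
  have hsub : ({ω | a < X t ω} ∩ {ω | X s ω ≤ b}) ⊆
      ({ω | a < X t ω} ∩ {ω | X s ω - ρ * X t ω ∈ Iic (-z)}) := by
    rintro ω ⟨h3, h4⟩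
    refine ⟨h3, ?_⟩
    simp only [mem_ofPred_eq] at h3 h4
    show X s ω - ρ * X t ω ≤ -z
    have := mul_le_mul_of_nonneg_left h3.le h0
    linarith
  refine (measureReal_mono hsub).trans ?_
  rw [hG.indep_real hr0 hs ht (by nlinarith) a measurableSet_Iic]
  have := Psi_nonneg a
  gcongr
  have := gauss_chernoff' (v := Real.toNNReal (1 - ρ ^ 2)) (w := 2 * η) (x := z) (by positivity)
    (by rw [Real.coe_toNNReal _ (by nlinarith)]; nlinarith) hz
  refine this.trans (le_of_eq ?_)
  congr 2; ring

lemma summable_chain {θ κ : ℝ} (hθ : 0 < θ) (hθ1 : θ < 1) (hκ : 0 < κ) :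
    Summable fun n : ℕ => (2:ℝ) ^ (n + 2) * Real.exp (-(κ / (4 * θ ^ (2 * n)))) := by
  obtain ⟨N, hN⟩ := exists_pow_lt_of_lt_one (show (0:ℝ) < 1/4 by norm_num) hθ1
  have hs : Summable fun n : ℕ => (4 * (N.factorial : ℝ) * (4 / κ) ^ N) * (1/2 : ℝ) ^ n :=
    (summable_geometric_of_lt_one (by norm_num) (by norm_num)).mul_left _
  refine Summable.of_nonneg_of_le (fun n => by positivity) (fun n => ?_) hs
  have hx : 0 < κ / (4 * θ ^ (2 * n)) := by positivity
  have h1 := Real.pow_div_factorial_le_exp _ hx.le N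
  have h2 : Real.exp (-(κ / (4 * θ ^ (2 * n)))) ≤ N.factorial * (4 / κ) ^ N * (θ ^ (2 * n)) ^ N := by
    rw [Real.exp_neg]
    have h3 := inv_anti₀ (by positivity) h1
    refine h3.trans (le_of_eq ?_)
    rw [inv_div, div_pow, div_pow, mul_pow]
    field_simp
  have h4 : (θ ^ (2 * n)) ^ N ≤ (1/4 : ℝ) ^ n := by
    calc (θ ^ (2 * n)) ^ N = (θ ^ N) ^ (2 * n) := by rw [← pow_mul, ← pow_mul]; ring_nf
      _ ≤ (1/4 : ℝ) ^ (2 * n) := by gcongr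
      _ ≤ (1/4 : ℝ) ^ n := pow_le_pow_of_le_one (by norm_num) (by norm_num) (by omega)
  calc (2:ℝ) ^ (n + 2) * Real.exp (-(κ / (4 * θ ^ (2 * n))))
      ≤ (2:ℝ) ^ (n + 2) * (N.factorial * (4 / κ) ^ N * (1/4 : ℝ) ^ n) := by
        gcongr
        exact h2.trans (by gcongr)
    _ = _ := by
        have : (1/4 : ℝ) ^ n = (1/2) ^ n * (1/2) ^ n := by rw [← mul_pow]; norm_num
        have h5 : (2:ℝ) ^ n * (1/2) ^ n = 1 := by rw [← mul_pow]; norm_num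
        rw [this, pow_add]
        linear_combination (4 * (N.factorial : ℝ) * (4 / κ) ^ N * (1/2) ^ n) * h5

lemma GP.chain (hG : GP P X r) (hr0 : r 0 = 1)
    (hcont : ∀ᵐ ω ∂P, ContinuousOn (fun t => X t ω) (Ici 0))
    {θ κ u h s : ℝ} (hθ : 0 < θ) (hθ1 : θ < 1) (hκ : κ = (1 - θ) / 2) (hu : 2 ≤ u) (hh : 0 < h)
    (hs : 0 ≤ s)
    (H : ∀ n : ℕ, 0 ≤ r (h / 2 ^ (n + 1)) ∧ r (h / 2 ^ (n + 1)) ≤ 1 ∧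
      1 - r (h / 2 ^ (n + 1)) ≤ κ * θ ^ (4 * n) / u ^ 2) :
    P {ω | ∃ t ∈ Icc s (s + h), u < X t ω} ≤
      ENNReal.ofReal ((2 + ∑' n : ℕ, (2:ℝ) ^ (n + 2) * Real.exp (-(κ / (4 * θ ^ (2 * n))))) *
        Psi (u - 1 / u)) := by
  have hκ0 : 0 < κ := by rw [hκ]; linarith
  have hu0 : 0 < u := by linarith
  set pt : ℕ → ℕ → ℝ := fun n k => s + h * k / 2 ^ n with hpt
  have hpt0 : ∀ n k, 0 ≤ pt n k := fun n k => by simp only [hpt]; positivity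
  set lev : ℕ → ℝ := fun n => u - θ ^ n / u with hlev
  set S : ℕ → ℕ → Set Ω := fun n k => {ω | lev (n + 1) < X (pt (n + 1) k) ω} ∩
    {ω | X (pt n (k / 2)) ω ≤ lev n} with hS
  have hlev_le : ∀ n, lev 0 ≤ lev n := by
    intro n
    simp only [hlev]
    have : θ ^ n ≤ θ ^ 0 := pow_le_pow_of_le_one hθ.le hθ1.le (Nat.zero_le n)
    gcongr
  have hlev0 : lev 0 = u - 1 / u := by simp [hlev]
  have hlevpos : ∀ n, 0 ≤ lev n := by
    intro n
    refine le_trans ?_ (hlev_le n)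
    rw [hlev0]
    have : 1 / u ≤ 1 := by rw [div_le_one hu0]; linarith
    linarith
  have hlevlt : ∀ n, lev n < u := by
    intro n; simp only [hlev]
    have : 0 < θ ^ n / u := by positivity
    linarith
  -- each step event
  have hstep : ∀ n k, P (S n k) ≤
      ENNReal.ofReal (Psi (u - 1 / u) * Real.exp (-(κ / (4 * θ ^ (2 * n))))) := by
    intro n k
    rw [← ENNReal.ofReal_toReal (measure_ne_top P (S n k))]
    apply ENNReal.ofReal_le_ofReal
    change P.real (S n k) ≤ _
    have hd : |pt n (k / 2) - pt (n + 1) k| = 0 ∨ |pt n (k / 2) - pt (n + 1) k| = h / 2 ^ (n + 1) := by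
      have hk : (k:ℝ) = 2 * ((k / 2 : ℕ) : ℝ) + ((k % 2 : ℕ) : ℝ) := by
        exact_mod_cast (Nat.div_add_mod k 2).symm
      have e : pt n (k / 2) - pt (n + 1) k = - (((k % 2 : ℕ) : ℝ) * (h / 2 ^ (n + 1))) := by
        simp only [hpt]; rw [hk, pow_succ]; field_simp; ring
      rw [e, abs_neg]
      rcases Nat.mod_two_eq_zero_or_one k with h2 | h2
      · left; rw [h2]; simp
      · right; rw [h2, Nat.cast_one, one_mul, abs_of_pos (by positivity)]
    have hη : 0 < κ * θ ^ (4 * n) / u ^ 2 := by positivity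
    have hρ : 0 ≤ r |pt n (k / 2) - pt (n + 1) k| ∧ r |pt n (k / 2) - pt (n + 1) k| ≤ 1 ∧
        1 - r |pt n (k / 2) - pt (n + 1) k| ≤ κ * θ ^ (4 * n) / u ^ 2 := by
      rcases hd with hd | hd
      · rw [hd, hr0]; exact ⟨by norm_num, le_rfl, by linarith⟩
      · rw [hd]; exact H n
    obtain ⟨g0, g1, g2⟩ := hρ
    have hab : lev n - r |pt n (k / 2) - pt (n + 1) k| * lev (n + 1) ≤ - (κ * θ ^ n / u) := by
      have e1 : (1 - r |pt n (k / 2) - pt (n + 1) k|) * lev (n + 1) ≤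
          κ * θ ^ (4 * n) / u ^ 2 * u := by
        have := hlevpos (n + 1)
        have := hlevlt (n + 1)
        gcongr
      have e2 : κ * θ ^ (4 * n) / u ^ 2 * u ≤ κ * θ ^ n / u := by
        have e3 : κ * θ ^ (4 * n) / u ^ 2 * u = κ * θ ^ (4 * n) / u := by field_simp
        rw [e3]
        have : θ ^ (4 * n) ≤ θ ^ n := pow_le_pow_of_le_one hθ.le hθ1.le (by omega)
        gcongr
      have e4 : lev n - lev (n + 1) = - (2 * (κ * θ ^ n / u)) := by
        simp only [hlev, hκ, pow_succ]; field_simp; ring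
      linarith
    have := hG.chain_step hr0 (hpt0 n (k / 2)) (hpt0 (n + 1) k) g0 g1 hη g2 (by positivity) hab
    refine this.trans ?_
    have e5 : -(κ * θ ^ n / u) ^ 2 / (4 * (κ * θ ^ (4 * n) / u ^ 2)) = -(κ / (4 * θ ^ (2 * n))) := by
      have : θ ^ (4 * n) = θ ^ (2 * n) * θ ^ (2 * n) := by rw [← pow_add]; ring_nf
      rw [this, div_pow, mul_pow, ← pow_mul, mul_comm n 2]
      field_simp
    rw [e5]
    gcongr
    rw [← hlev0]
    exact Psi_anti (hlev_le _)
  -- inclusion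
  have hinc : ∀ ω, ContinuousOn (fun t => X t ω) (Ici 0) → (∃ t ∈ Icc s (s + h), u < X t ω) →
      ω ∈ ({ω | lev 0 < X s ω} ∪ {ω | lev 0 < X (s + h) ω}) ∪
        ⋃ n : ℕ, ⋃ k ∈ Finset.range (2 ^ (n + 1) + 1), S n k := by
    rintro ω hω ⟨t, ht, hut⟩
    by_contra hnot
    simp only [mem_union, mem_ofPred_eq, mem_iUnion, Finset.mem_range, not_or, not_exists,
      not_lt] at hnot
    obtain ⟨⟨n1, n2⟩, n3⟩ := hnot
    have hind : ∀ n k, k ≤ 2 ^ n → X (pt n k) ω ≤ lev n := by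
      intro n
      induction n with
      | zero =>
        intro k hk
        have : k = 0 ∨ k = 1 := by simp at hk; omega
        rcases this with rfl | rfl
        · simpa [hpt] using n1
        · simpa [hpt] using n2
      | succ n ih =>
        intro k hk
        by_contra hc
        push Not at hc
        exact n3 n k (by omega) ⟨hc, ih (k / 2) (by rw [pow_succ] at hk; omega)⟩
    -- approximating sequence
    have hlim : Tendsto (fun n : ℕ => pt n ⌊(t - s) / h * 2 ^ n⌋₊) atTop (𝓝 t) := by
      have h1 : Tendsto (fun n : ℕ => (2:ℝ) ^ n) atTop atTop :=
        tendsto_pow_atTop_atTop_of_one_lt (by norm_num)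
      have h2 := (tendsto_nat_floor_mul_div_atTop
        (show 0 ≤ (t - s) / h from div_nonneg (by linarith [ht.1]) hh.le)).comp h1
      have h3 := (h2.const_mul h).const_add s
      have e : s + h * ((t - s) / h) = t := by field_simp; ring
      rw [e] at h3
      refine h3.congr fun n => ?_
      simp only [hpt, Function.comp]; ring
    have ht0 : t ∈ Ici (0:ℝ) := hs.trans ht.1
    have hlim2 : Tendsto (fun n : ℕ => X (pt n ⌊(t - s) / h * 2 ^ n⌋₊) ω) atTop (𝓝 (X t ω)) := by
      have h4 : Tendsto (fun n : ℕ => pt n ⌊(t - s) / h * 2 ^ n⌋₊) atTop (𝓝[Ici 0] t) :=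
        tendsto_nhdsWithin_iff.2 ⟨hlim, Eventually.of_forall fun n => hpt0 _ _⟩
      exact Tendsto.comp (hω t ht0) h4
    have : X t ω ≤ u := by
      refine le_of_tendsto hlim2 (Eventually.of_forall fun n => ?_)
      refine (hind n _ ?_).trans (hlevlt n).le
      apply Nat.floor_le_of_le
      push_cast
      have : (t - s) / h ≤ 1 := by rw [div_le_one hh]; linarith [ht.2]
      have h5 : (0:ℝ) < 2 ^ n := by positivity
      nlinarith
    linarith
  have hPsi0 := Psi_nonneg (u - 1 / u)
  have hsum := summable_chain hθ hθ1 hκ0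
  calc P {ω | ∃ t ∈ Icc s (s + h), u < X t ω}
      ≤ P (({ω | lev 0 < X s ω} ∪ {ω | lev 0 < X (s + h) ω}) ∪
        ⋃ n : ℕ, ⋃ k ∈ Finset.range (2 ^ (n + 1) + 1), S n k) := by
        apply measure_mono_ae
        filter_upwards [hcont] with ω hω h2
        exact hinc ω hω h2
    _ ≤ (P {ω | lev 0 < X s ω} + P {ω | lev 0 < X (s + h) ω}) +
        ∑' n : ℕ, ∑ k ∈ Finset.range (2 ^ (n + 1) + 1), P (S n k) := by
        refine (measure_union_le _ _).trans (add_le_add (measure_union_le _ _) ?_)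
        refine (measure_iUnion_le _).trans (ENNReal.tsum_le_tsum fun n => ?_)
        exact measure_biUnion_finset_le _ _
    _ ≤ (ENNReal.ofReal (Psi (u - 1 / u)) + ENNReal.ofReal (Psi (u - 1 / u))) +
        ∑' n : ℕ, ENNReal.ofReal ((2:ℝ) ^ (n + 2) * Real.exp (-(κ / (4 * θ ^ (2 * n)))) *
          Psi (u - 1 / u)) := by
        refine add_le_add (add_le_add ?_ ?_) (ENNReal.tsum_le_tsum fun n => ?_)
        · rw [← hlev0, ← hG.tail hr0 hs, ofReal_measureReal]
        · rw [← hlev0, ← hG.tail hr0 (show 0 ≤ s + h by positivity), ofReal_measureReal]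
        · refine (Finset.sum_le_sum fun k _ => hstep n k).trans ?_
          rw [Finset.sum_const, nsmul_eq_mul, Finset.card_range, ← ENNReal.ofReal_natCast,
            ← ENNReal.ofReal_mul (by positivity)]
          apply ENNReal.ofReal_le_ofReal
          have : ((2 ^ (n + 1) + 1 : ℕ) : ℝ) ≤ 2 ^ (n + 2) := by
            have : 2 ^ (n + 1) + 1 ≤ 2 ^ (n + 2) := by
              have := Nat.one_le_two_pow (n := n + 1)
              rw [pow_succ 2 (n + 1)]; omega
            exact_mod_cast this
          rw [mul_assoc, mul_comm (Psi _)]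
          gcongr
    _ = _ := by
        rw [← ENNReal.ofReal_tsum_of_nonneg (fun n => by positivity) (hsum.mul_right _),
          ← ENNReal.ofReal_add hPsi0 hPsi0, ← ENNReal.ofReal_add (by positivity)
          (tsum_nonneg fun n => by positivity), tsum_mul_right]
        congr 1; ring
end C


lemma r_local {r : ℝ → ℝ} {C α : ℝ} (hα : 0 < α) (hC : 0 < C)
    (hA1 : (fun t => r t - (1 - C * |t| ^ α)) =o[𝓝[>] (0:ℝ)] fun t => |t| ^ α) :
    ∃ δ, 0 < δ ∧ ∀ τ, 0 < τ → τ ≤ δ → 0 ≤ r τ ∧ r τ ≤ 1 ∧ 1 - r τ ≤ 2 * C * τ ^ α ∧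
      C / 2 * τ ^ α ≤ 1 - r τ := by
  have h1 := hA1.bound (show 0 < C / 2 by positivity)
  have h2 : Tendsto (fun t : ℝ => 2 * C * t ^ α) (𝓝[>] 0) (𝓝 0) := by
    have : Tendsto (fun t : ℝ => t ^ α) (𝓝 0) (𝓝 (0 ^ α)) :=
      (Real.continuousAt_rpow_const 0 α (Or.inr hα.le)).tendsto
    rw [Real.zero_rpow hα.ne'] at this
    simpa using (this.const_mul (2 * C)).mono_left nhdsWithin_le_nhds
  have h3 := h2.eventually (gt_mem_nhds (show (0:ℝ) < 1 by norm_num))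
  obtain ⟨δ, hδ, hsub⟩ := mem_nhdsGT_iff_exists_Ioc_subset.1 (h1.and h3)
  refine ⟨δ, hδ, fun τ h0 hτ => ?_⟩
  obtain ⟨g1, g2⟩ := hsub ⟨h0, hτ⟩
  have hp : 0 < τ ^ α := Real.rpow_pos_of_pos h0 α
  rw [abs_of_pos h0, Real.norm_eq_abs, Real.norm_eq_abs, abs_of_pos hp, abs_le] at g1
  have : 0 < C * τ ^ α := by positivity
  refine ⟨?_, ?_, ?_, ?_⟩ <;> nlinarith [g1.1, g1.2]

lemma r_tendsto_one {r : ℝ → ℝ} {C α : ℝ} (hα : 0 < α) (hC : 0 < C)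
    (hA1 : (fun t => r t - (1 - C * |t| ^ α)) =o[𝓝[>] (0:ℝ)] fun t => |t| ^ α) :
    Tendsto r (𝓝[>] 0) (𝓝 1) := by
  obtain ⟨δ, hδ, H⟩ := r_local hα hC hA1
  have h2 : Tendsto (fun t : ℝ => 1 - 2 * C * t ^ α) (𝓝[>] 0) (𝓝 1) := by
    have : Tendsto (fun t : ℝ => t ^ α) (𝓝 0) (𝓝 (0 ^ α)) :=
      (Real.continuousAt_rpow_const 0 α (Or.inr hα.le)).tendsto
    rw [Real.zero_rpow hα.ne'] at this
    simpa using ((this.const_mul (2 * C)).const_sub 1).mono_left nhdsWithin_le_nhds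
  refine tendsto_of_tendsto_of_tendsto_of_le_of_le' h2 tendsto_const_nhds ?_ ?_
  · filter_upwards [Ioc_mem_nhdsGT hδ] with t ht
    linarith [(H t ht.1 ht.2).2.2.1]
  · filter_upwards [Ioc_mem_nhdsGT hδ] with t ht
    exact (H t ht.1 ht.2).2.1

lemma Psi_near {u : ℝ} (hu : 2 ≤ u) : Psi (u - 1 / u) ≤ 6 * (Real.exp (-u ^ 2 / 2) / u) := by
  have hu0 : 0 < u := by linarith
  have h1 : 1 / u ≤ u / 2 := by rw [div_le_iff₀ hu0]; nlinarith
  have h2 : u / 2 ≤ u - 1 / u := by linarith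
  refine (Psi_le (by linarith)).trans ?_
  have h3 : Real.exp (-(u - 1 / u) ^ 2 / 2) ≤ 3 * Real.exp (-u ^ 2 / 2) := by
    have : Real.exp (-(u - 1 / u) ^ 2 / 2) ≤ Real.exp 1 * Real.exp (-u ^ 2 / 2) := by
      rw [← Real.exp_add]; apply Real.exp_le_exp.2
      have : (u - 1 / u) ^ 2 = u ^ 2 - 2 + (1 / u) ^ 2 := by field_simp; ring
      rw [this]; nlinarith [sq_nonneg (1 / u)]
    have h4 := Real.exp_one_lt_d9
    nlinarith [Real.exp_pos (-u ^ 2 / 2)]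
  calc Real.exp (-(u - 1 / u) ^ 2 / 2) / (u - 1 / u) ≤ (3 * Real.exp (-u ^ 2 / 2)) / (u / 2) := by
        gcongr
    _ = _ := by field_simp; ring

/-- The time scale. -/
noncomputable def mscale (α u : ℝ) : ℝ := u ^ ((α - 2) / α) * Real.exp (u ^ 2 / 2)

lemma mscale_pos {α u : ℝ} (hu : 0 < u) : 0 < mscale α u := by
  unfold mscale; have := Real.rpow_pos_of_pos hu ((α - 2) / α); positivity

lemma mscale_inv {α u : ℝ} (hα : 0 < α) (hu : 0 < u) :
    u ^ (2 / α) * (Real.exp (-u ^ 2 / 2) / u) = 1 / mscale α u := by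
  unfold mscale
  have h1 : u ^ ((α - 2) / α) * u ^ (2 / α) = u := by
    rw [← Real.rpow_add hu]
    have : (α - 2) / α + 2 / α = 1 := by field_simp; ring
    rw [this, Real.rpow_one]
  have h2 : Real.exp (-u ^ 2 / 2) * Real.exp (u ^ 2 / 2) = 1 := by
    rw [← Real.exp_add]; simp [neg_div]
  have := Real.rpow_pos_of_pos hu ((α - 2) / α)
  rw [eq_div_iff (by positivity)]
  calc u ^ (2 / α) * (Real.exp (-u ^ 2 / 2) / u) * (u ^ ((α - 2) / α) * Real.exp (u ^ 2 / 2))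
      = (u ^ ((α - 2) / α) * u ^ (2 / α)) / u * (Real.exp (-u ^ 2 / 2) * Real.exp (u ^ 2 / 2)) := by
        ring
    _ = 1 := by rw [h1, h2]; field_simp

set_option linter.unusedSectionVars false
section D
variable {Ω : Type*} [MeasurableSpace Ω] {P : Measure Ω} [IsProbabilityMeasure P]
  {X : ℝ → Ω → ℝ} {r : ℝ → ℝ}

lemma GP.unit_interval (hG : GP P X r) (hr0 : r 0 = 1)
    (hcont : ∀ᵐ ω ∂P, ContinuousOn (fun t => X t ω) (Ici 0))
    {C α δ : ℝ} (hα : 0 < α) (hC : 0 < C) (hδ : 0 < δ)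
    (hloc : ∀ τ, 0 < τ → τ ≤ δ → 0 ≤ r τ ∧ r τ ≤ 1 ∧ 1 - r τ ≤ 2 * C * τ ^ α ∧
      C / 2 * τ ^ α ≤ 1 - r τ) :
    ∃ K, 0 < K ∧ ∀ᶠ u in atTop, ∀ k : ℕ,
      P {ω | ∃ t ∈ Icc (k:ℝ) (k + 1), u < X t ω} ≤ ENNReal.ofReal (K / mscale α u) := by
  set θ : ℝ := 2 ^ (-(α / 4)) with hθd
  have hθ : 0 < θ := by positivity
  have hθ1 : θ < 1 := Real.rpow_lt_one_of_one_lt_of_neg (by norm_num) (by linarith)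
  have hθ4 : θ ^ 4 = 2 ^ (-α) := by
    rw [hθd, ← Real.rpow_natCast, ← Real.rpow_mul (by norm_num)]
    congr 1; push_cast; ring
  set κ : ℝ := (1 - θ) / 2 with hκ
  have hκ0 : 0 < κ := by rw [hκ]; linarith
  set h0 : ℝ := (κ / (2 * C)) ^ (1 / α) with hh0
  have hh0pos : 0 < h0 := Real.rpow_pos_of_pos (by positivity) _
  have hh0α : h0 ^ α = κ / (2 * C) := by
    rw [hh0, ← Real.rpow_mul (by positivity), one_div_mul_cancel hα.ne', Real.rpow_one]
  set K0 : ℝ := 2 + ∑' n : ℕ, (2:ℝ) ^ (n + 2) * Real.exp (-(κ / (4 * θ ^ (2 * n)))) with hK0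
  have hK0pos : 0 < K0 := by
    have : 0 ≤ ∑' n : ℕ, (2:ℝ) ^ (n + 2) * Real.exp (-(κ / (4 * θ ^ (2 * n)))) :=
      tsum_nonneg fun n => by positivity
    rw [hK0]; linarith
  refine ⟨2 / h0 * K0 * 6, by positivity, ?_⟩
  have hlim : Tendsto (fun u : ℝ => h0 * u ^ (-(2 / α))) atTop (𝓝 0) := by
    simpa using (tendsto_rpow_neg_atTop (show 0 < 2 / α by positivity)).const_mul h0
  filter_upwards [eventually_ge_atTop 2, hlim.eventually (gt_mem_nhds hδ),
    hlim.eventually (gt_mem_nhds one_pos)] with u hu hu1 hu2 k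
  set h := h0 * u ^ (-(2 / α)) with hh
  have hu0 : 0 < u := by linarith
  have hhpos : 0 < h := by have := Real.rpow_pos_of_pos hu0 (-(2 / α)); positivity
  have hhα : h ^ α = κ / (2 * C) / u ^ 2 := by
    rw [hh, Real.mul_rpow hh0pos.le (Real.rpow_nonneg hu0.le _), hh0α, ← Real.rpow_mul hu0.le]
    have : -(2 / α) * α = -(2:ℕ) := by field_simp; norm_num
    rw [this, Real.rpow_neg hu0.le, Real.rpow_natCast]; rfl
  have H : ∀ n : ℕ, 0 ≤ r (h / 2 ^ (n + 1)) ∧ r (h / 2 ^ (n + 1)) ≤ 1 ∧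
      1 - r (h / 2 ^ (n + 1)) ≤ κ * θ ^ (4 * n) / u ^ 2 := by
    intro n
    have hle : h / 2 ^ (n + 1) ≤ h := div_le_self hhpos.le (one_le_pow₀ (by norm_num))
    obtain ⟨g1, g2, g3, -⟩ := hloc (h / 2 ^ (n + 1)) (by positivity) (hle.trans hu1.le)
    refine ⟨g1, g2, g3.trans ?_⟩
    have e1 : (h / 2 ^ (n + 1)) ^ α ≤ (h / 2 ^ n) ^ α := by
      apply Real.rpow_le_rpow (by positivity) _ hα.le
      gcongr <;> norm_num
    have e2 : (h / 2 ^ n) ^ α = κ / (2 * C) / u ^ 2 * θ ^ (4 * n) := by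
      rw [Real.div_rpow hhpos.le (by positivity), hhα, pow_mul, hθ4, ← Real.rpow_natCast 2 n,
        ← Real.rpow_mul (by norm_num), ← Real.rpow_natCast (2 ^ (-α)) n,
        ← Real.rpow_mul (by norm_num), neg_mul, Real.rpow_neg (by norm_num), mul_comm α]
      rfl
    calc 2 * C * (h / 2 ^ (n + 1)) ^ α ≤ 2 * C * (h / 2 ^ n) ^ α := by gcongr
      _ = _ := by rw [e2]; field_simp
  have hcov : {ω | ∃ t ∈ Icc (k:ℝ) (k + 1), u < X t ω} ⊆
      ⋃ j ∈ Finset.range (⌊1 / h⌋₊ + 1), {ω | ∃ t ∈ Icc ((k:ℝ) + j * h) (k + j * h + h), u < X t ω} := by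
    rintro ω ⟨t, ht, hut⟩
    simp only [mem_iUnion, Finset.mem_range]
    have hnn : 0 ≤ (t - k) / h := div_nonneg (by linarith [ht.1]) hhpos.le
    refine ⟨⌊(t - k) / h⌋₊, ?_, t, ⟨?_, ?_⟩, hut⟩
    · refine Nat.lt_succ_of_le (Nat.floor_le_floor ?_)
      gcongr; linarith [ht.2]
    · have := Nat.floor_le hnn
      rw [le_div_iff₀ hhpos] at this; linarith
    · have := Nat.lt_floor_add_one ((t - k) / h)
      rw [div_lt_iff₀ hhpos] at this; linarith
  calc P {ω | ∃ t ∈ Icc (k:ℝ) (k + 1), u < X t ω}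
      ≤ ∑ j ∈ Finset.range (⌊1 / h⌋₊ + 1),
          P {ω | ∃ t ∈ Icc ((k:ℝ) + j * h) (k + j * h + h), u < X t ω} :=
        (measure_mono hcov).trans (measure_biUnion_finset_le _ _)
    _ ≤ ∑ j ∈ Finset.range (⌊1 / h⌋₊ + 1), ENNReal.ofReal (K0 * Psi (u - 1 / u)) := by
        refine Finset.sum_le_sum fun j _ => ?_
        exact hG.chain hr0 hcont hθ hθ1 hκ hu hhpos (by positivity) H
    _ ≤ _ := by
        rw [Finset.sum_const, nsmul_eq_mul, Finset.card_range, ← ENNReal.ofReal_natCast,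
            ← ENNReal.ofReal_mul (by positivity)]
        apply ENNReal.ofReal_le_ofReal
        have e1 : ((⌊1 / h⌋₊ + 1 : ℕ) : ℝ) ≤ 2 / h := by
          have := Nat.floor_le (show 0 ≤ 1 / h by positivity)
          have h1 : 1 ≤ 1 / h := by rw [le_div_iff₀ hhpos]; linarith
          have h2 : 2 / h = 1 / h + 1 / h := by ring
          push_cast; linarith
        have e2 : 2 / h = 2 / h0 * u ^ (2 / α) := by
          rw [hh, Real.rpow_neg hu0.le]; field_simp
        have hPn := Psi_nonneg (u - 1 / u)
        calc ((⌊1 / h⌋₊ + 1 : ℕ) : ℝ) * (K0 * Psi (u - 1 / u))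
            ≤ 2 / h * (K0 * (6 * (Real.exp (-u ^ 2 / 2) / u))) := by
              have := Psi_near hu
              gcongr
          _ = 2 / h0 * K0 * 6 * (u ^ (2 / α) * (Real.exp (-u ^ 2 / 2) / u)) := by rw [e2]; ring
          _ = _ := by rw [mscale_inv hα hu0]; ring
end D


set_option linter.unusedSectionVars false
section E
variable {Ω : Type*} [MeasurableSpace Ω] {P : Measure Ω} [IsProbabilityMeasure P]
  {X : ℝ → Ω → ℝ} {r : ℝ → ℝ}

lemma second_moment (E : ℕ → Set Ω) (hE : ∀ j, NullMeasurableSet (E j) P) (n : ℕ) (p : ℝ)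
    (hp : ∀ j, P.real (E j) = p) :
    (n * p) ^ 2 * P.real {ω | ∀ j < n, ω ∉ E j} ≤
      ∑ i ∈ Finset.range n, ∑ j ∈ Finset.range n, P.real (E i ∩ E j) - (n * p) ^ 2 := by
  classical
  set I : ℕ → Ω → ℝ := fun j => (E j).indicator (fun _ => 1) with hI
  have hintg : ∀ S : Set Ω, NullMeasurableSet S P → Integrable (S.indicator (fun _ => (1:ℝ))) P :=
    fun S hS => (integrable_const (1:ℝ)).indicator₀ hS
  have hval : ∀ S : Set Ω, NullMeasurableSet S P → ∫ ω, S.indicator (fun _ => (1:ℝ)) ω ∂P = P.real S := by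
    intro S hS
    rw [integral_indicator₀ hS]; simp
  have hA : NullMeasurableSet {ω | ∀ j < n, ω ∉ E j} P := by
    have : {ω | ∀ j < n, ω ∉ E j} = ⋂ j, ⋂ (_ : j < n), (E j)ᶜ := by
      ext ω; simp
    rw [this]
    exact NullMeasurableSet.iInter fun j => NullMeasurableSet.iInter fun _ => (hE j).compl
  have hII : ∀ i j ω, I i ω * I j ω = (E i ∩ E j).indicator (fun _ => (1:ℝ)) ω := by
    intro i j ω
    simp only [hI, Set.indicator_apply, mem_inter_iff]
    by_cases h1 : ω ∈ E i <;> by_cases h2 : ω ∈ E j <;> simp [h1, h2]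
  have hexp : ∀ ω, (∑ j ∈ Finset.range n, I j ω - n * p) ^ 2 =
      ∑ i ∈ Finset.range n, ∑ j ∈ Finset.range n, (E i ∩ E j).indicator (fun _ => (1:ℝ)) ω
        - 2 * (n * p) * ∑ j ∈ Finset.range n, I j ω + (n * p) ^ 2 := by
    intro ω
    have : (∑ j ∈ Finset.range n, I j ω) ^ 2 = ∑ i ∈ Finset.range n, ∑ j ∈ Finset.range n,
        (E i ∩ E j).indicator (fun _ => (1:ℝ)) ω := by
      rw [sq, Finset.sum_mul_sum]; simp_rw [hII]
    rw [← this]; ring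
  have hi1 : Integrable (fun ω => ∑ i ∈ Finset.range n, ∑ j ∈ Finset.range n,
      (E i ∩ E j).indicator (fun _ => (1:ℝ)) ω) P :=
    integrable_finsetSum _ fun i _ => integrable_finsetSum _ fun j _ =>
      hintg _ ((hE i).inter (hE j))
  have hi2 : Integrable (fun ω => ∑ j ∈ Finset.range n, I j ω) P :=
    integrable_finsetSum _ fun j _ => hintg _ (hE j)
  have hi3 : Integrable (fun ω => (∑ j ∈ Finset.range n, I j ω - n * p) ^ 2) P := by
    simp_rw [hexp]
    exact (hi1.sub (hi2.const_mul _)).add (integrable_const _)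
  have hlhs : (n * p) ^ 2 * P.real {ω | ∀ j < n, ω ∉ E j} =
      ∫ ω, (n * p) ^ 2 * ({ω | ∀ j < n, ω ∉ E j}).indicator (fun _ => (1:ℝ)) ω ∂P := by
    rw [integral_const_mul, hval _ hA]
  have hrhs : ∫ ω, (∑ j ∈ Finset.range n, I j ω - n * p) ^ 2 ∂P =
      ∑ i ∈ Finset.range n, ∑ j ∈ Finset.range n, P.real (E i ∩ E j) - (n * p) ^ 2 := by
    simp_rw [hexp]
    have hi4 : Integrable (fun ω => ∑ i ∈ Finset.range n, ∑ j ∈ Finset.range n,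
        (E i ∩ E j).indicator (fun _ => (1:ℝ)) ω
        - 2 * (n * p) * ∑ j ∈ Finset.range n, I j ω) P := hi1.sub (hi2.const_mul _)
    rw [integral_add hi4 (integrable_const _),
      integral_sub hi1 (hi2.const_mul _), integral_const_mul,
      integral_finsetSum _ (fun j _ => hintg _ (hE j)),
      integral_finsetSum _ (fun i _ => integrable_finsetSum _ fun j _ =>
        hintg _ ((hE i).inter (hE j)))]
    have e1 : ∀ i ∈ Finset.range n, ∫ ω, ∑ j ∈ Finset.range n,
        (E i ∩ E j).indicator (fun _ => (1:ℝ)) ω ∂P = ∑ j ∈ Finset.range n, P.real (E i ∩ E j) := by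
      intro i _
      rw [integral_finsetSum _ (fun j _ => hintg _ ((hE i).inter (hE j)))]
      exact Finset.sum_congr rfl fun j _ => hval _ ((hE i).inter (hE j))
    rw [Finset.sum_congr rfl e1]
    have e2 : ∀ j ∈ Finset.range n, ∫ ω, I j ω ∂P = p := fun j _ => by
      rw [← hp j]; exact hval _ (hE j)
    rw [Finset.sum_congr rfl e2]
    simp; ring
  rw [hlhs, ← hrhs]
  refine integral_mono ((hintg _ hA).const_mul _) hi3 fun ω => ?_
  simp only [Set.indicator_apply]
  split_ifs with h
  · have : ∑ j ∈ Finset.range n, I j ω = 0 := by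
      refine Finset.sum_eq_zero fun j hj => ?_
      simp only [hI]
      rw [Set.indicator_of_notMem]
      exact h j (Finset.mem_range.1 hj)
    rw [this]; apply le_of_eq; ring
  · simp; positivity

/-- Natural number distance. -/
def ndist (i j : ℕ) : ℕ := (i - j) + (j - i)

lemma ndist_cast (i j : ℕ) : |(i:ℝ) - j| = ndist i j := by
  unfold ndist
  rcases le_total i j with h | h
  · rw [abs_of_nonpos (by simpa using h)]
    simp [Nat.sub_eq_zero_of_le h, Nat.cast_sub h]
  · rw [abs_of_nonneg (by simpa using h)]
    simp [Nat.sub_eq_zero_of_le h, Nat.cast_sub h]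

lemma sum_ndist (g : ℕ → ℝ) (hg : ∀ k, 0 ≤ g k) (n i : ℕ) (hi : i < n) :
    ∑ j ∈ Finset.range n, g (ndist i j) ≤ 2 * ∑ k ∈ Finset.range n, g k := by
  have h1 : ∑ j ∈ (Finset.range n).filter (fun j => j ≤ i), g (ndist i j) ≤
      ∑ k ∈ Finset.range n, g k := by
    have hinj : Set.InjOn (fun j => ndist i j) ((Finset.range n).filter (fun j => j ≤ i) : Finset ℕ) := by
      intro a ha b hb hab
      simp only [Finset.coe_filter, mem_ofPred_eq, ndist] at ha hb hab
      omega
    rw [← Finset.sum_image hinj]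
    refine Finset.sum_le_sum_of_subset_of_nonneg ?_ fun k _ _ => hg k
    intro k hk
    simp only [Finset.mem_image, Finset.mem_filter, Finset.mem_range, ndist] at hk ⊢
    obtain ⟨a, ha, hb⟩ := hk
    omega
  have h2 : ∑ j ∈ (Finset.range n).filter (fun j => ¬ j ≤ i), g (ndist i j) ≤
      ∑ k ∈ Finset.range n, g k := by
    have hinj : Set.InjOn (fun j => ndist i j) ((Finset.range n).filter (fun j => ¬ j ≤ i) : Finset ℕ) := by
      intro a ha b hb hab
      simp only [Finset.coe_filter, mem_ofPred_eq, ndist] at ha hb hab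
      omega
    rw [← Finset.sum_image hinj]
    refine Finset.sum_le_sum_of_subset_of_nonneg ?_ fun k _ _ => hg k
    intro k hk
    simp only [Finset.mem_image, Finset.mem_filter, Finset.mem_range, ndist] at hk ⊢
    obtain ⟨a, ha, hb⟩ := hk
    omega
  rw [← Finset.sum_filter_add_sum_filter_not (Finset.range n) (fun j => j ≤ i)]
  linarith

lemma sum_mid {q E M : ℝ} (hq : 0 < q) (hE : 0 ≤ E) (hM : 0 ≤ M) (n : ℕ) :
    ∑ k ∈ Finset.range n, (if (k:ℝ) * q ≤ E then M else 0) ≤ (E / q + 1) * M := by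
  rw [← Finset.sum_filter, Finset.sum_const, nsmul_eq_mul]
  gcongr
  have : (Finset.range n).filter (fun k : ℕ => (k:ℝ) * q ≤ E) ⊆ Finset.range (⌊E / q⌋₊ + 1) := by
    intro k hk
    simp only [Finset.mem_filter, Finset.mem_range] at hk ⊢
    refine Nat.lt_succ_of_le (Nat.le_floor ?_)
    rw [le_div_iff₀ hq]; exact hk.2
  have h2 := Finset.card_le_card this
  rw [Finset.card_range] at h2
  have h3 : ((Finset.filter (fun k : ℕ => (k:ℝ) * q ≤ E) (Finset.range n)).card : ℝ) ≤ ⌊E / q⌋₊ + 1 := by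
    exact_mod_cast h2
  have := Nat.floor_le (show 0 ≤ E / q by positivity)
  linarith

lemma summable_near {C α : ℝ} (hα : 0 < α) (hC : 0 < C) :
    Summable fun k : ℕ => Real.exp (-(C / 8) * (k:ℝ) ^ α) := by
  obtain ⟨N, hN⟩ := exists_nat_gt (2 / α)
  have hN2 : 2 ≤ α * N := by rw [div_lt_iff₀ hα] at hN; linarith
  have hs : Summable fun k : ℕ => (N.factorial * (8 / C) ^ N) * (1 / (k:ℝ) ^ 2) :=
    (Real.summable_one_div_nat_pow.2 one_lt_two).mul_left _
  refine Summable.of_norm_bounded_eventually_nat hs ?_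
  filter_upwards [eventually_ge_atTop 1] with k hk
  have hk1 : (1:ℝ) ≤ k := by exact_mod_cast hk
  have hk0 : (0:ℝ) < k := by linarith
  have hpos := Real.rpow_pos_of_pos hk0 α
  rw [Real.norm_eq_abs, abs_of_pos (Real.exp_pos _)]
  have h1 := Real.pow_div_factorial_le_exp (C / 8 * (k:ℝ) ^ α) (by positivity) N
  rw [neg_mul, Real.exp_neg]
  refine (inv_anti₀ (by positivity) h1).trans ?_
  have h2 : (k:ℝ) ^ 2 ≤ ((k:ℝ) ^ α) ^ N := by
    rw [← Real.rpow_natCast, ← Real.rpow_natCast, ← Real.rpow_mul hk0.le]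
    exact Real.rpow_le_rpow_of_exponent_le hk1 (by exact_mod_cast hN2)
  rw [inv_div, mul_pow]
  calc (N.factorial:ℝ) / ((C / 8) ^ N * ((k:ℝ) ^ α) ^ N)
      ≤ N.factorial / ((C / 8) ^ N * (k:ℝ) ^ 2) := by gcongr
    _ = _ := by rw [div_pow, div_pow]; field_simp

lemma GP.pair_all (hG : GP P X r) (hr0 : r 0 = 1)
    {C α δ ρ E e u q : ℝ} (hα : 0 < α) (hC : 0 < C)
    (hloc : ∀ τ, 0 < τ → τ ≤ δ → 0 ≤ r τ ∧ r τ ≤ 1 ∧ 1 - r τ ≤ 2 * C * τ ^ α ∧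
      C / 2 * τ ^ α ≤ 1 - r τ)
    (hρ0 : 0 < ρ) (hρ : ∀ t, δ ≤ t → r t ≤ ρ)
    (he : ∀ t, E ≤ t → |r t| ≤ e) (he2 : e ≤ 1 / 4)
    (hu : 1 ≤ u) (hq : 0 < q) (hqα : q ^ α = 1 / u ^ 2) (i j : ℕ) :
    P.real ({ω | u < X (i * q) ω} ∩ {ω | u < X (j * q) ω}) ≤
      30 * Psi u * Real.exp (-(C / 8) * (ndist i j : ℝ) ^ α) +
      (if (ndist i j : ℝ) * q ≤ E then Real.exp (-u ^ 2 / (1 + ρ)) else 0) +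
      (Psi u * Psi (u - 2 * e * u) + Psi (2 * u)) := by
  have hu0 : 0 < u := by linarith
  have hd : |(i:ℝ) * q - j * q| = ndist i j * q := by
    rw [← sub_mul, abs_mul, ndist_cast, abs_of_pos hq]
  have hs : 0 ≤ (i:ℝ) * q := by positivity
  have ht : 0 ≤ (j:ℝ) * q := by positivity
  set d := ndist i j with hdd
  have hp := Psi_pos hu
  have hF : 0 ≤ Psi u * Psi (u - 2 * e * u) + Psi (2 * u) :=
    add_nonneg (mul_nonneg (Psi_nonneg _) (Psi_nonneg _)) (Psi_nonneg _)
  have hN : 0 ≤ 30 * Psi u * Real.exp (-(C / 8) * (d : ℝ) ^ α) := by positivity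
  have hM : 0 ≤ (if (d : ℝ) * q ≤ E then Real.exp (-u ^ 2 / (1 + ρ)) else 0) := by
    split_ifs <;> positivity
  by_cases h0 : d = 0
  · have h1 : P.real ({ω | u < X (i * q) ω} ∩ {ω | u < X (j * q) ω}) ≤ Psi u := by
      rw [← hG.tail hr0 hs u]; exact measureReal_mono inter_subset_left
    have h2 : Real.exp (-(C / 8) * (d : ℝ) ^ α) = 1 := by
      rw [h0]; simp [Real.zero_rpow hα.ne']
    rw [h2] at hN ⊢
    linarith
  · have hd1 : 0 < (d:ℝ) := by exact_mod_cast Nat.pos_of_ne_zero h0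
    by_cases h1 : (d:ℝ) * q ≤ δ
    · obtain ⟨g0, g1, -, g3⟩ := hloc (d * q) (by positivity) h1
      have h2 := hG.pair_le_near hr0 hs ht hu0 (by rw [hd]; exact g0) (by rw [hd]; exact g1)
      rw [hd] at h2
      have h3 : Real.exp (-u ^ 2 / 2) / u ≤ 30 * Psi u := by have := Psi_ge hu; linarith
      have h4 : Real.exp (-u ^ 2 * (1 - r (d * q)) / 4) ≤ Real.exp (-(C / 8) * (d : ℝ) ^ α) := by
        apply Real.exp_le_exp.2
        rw [Real.mul_rpow hd1.le hq.le, hqα] at g3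
        have : u ^ 2 * (C / 2 * ((d:ℝ) ^ α * (1 / u ^ 2))) ≤ u ^ 2 * (1 - r (d * q)) := by gcongr
        have e2 : u ^ 2 * (C / 2 * ((d:ℝ) ^ α * (1 / u ^ 2))) = C / 2 * (d:ℝ) ^ α := by field_simp
        rw [e2] at this
        linarith
      have h5 : Real.exp (-u ^ 2 / 2) / u * Real.exp (-u ^ 2 * (1 - r (d * q)) / 4) ≤
          30 * Psi u * Real.exp (-(C / 8) * (d : ℝ) ^ α) := by gcongr
      linarith
    · push Not at h1
      by_cases h2 : (d:ℝ) * q ≤ E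
      · have h3 := hG.pair_le hr0 hs ht hu0.le hρ0.le (by rw [hd]; exact hρ _ h1.le)
        rw [if_pos h2]
        linarith
      · push Not at h2
        have h3 := hG.pair_far hr0 hs ht hu0 (e := e) (by rw [hd]; exact he _ h2.le) he2
        linarith

lemma GP.no_exceed_bound (hG : GP P X r) (hr0 : r 0 = 1)
    {C α δ ρ E e u q : ℝ} (hα : 0 < α) (hC : 0 < C)
    (hloc : ∀ τ, 0 < τ → τ ≤ δ → 0 ≤ r τ ∧ r τ ≤ 1 ∧ 1 - r τ ≤ 2 * C * τ ^ α ∧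
      C / 2 * τ ^ α ≤ 1 - r τ)
    (hρ0 : 0 < ρ) (hρ : ∀ t, δ ≤ t → r t ≤ ρ) (hE : 0 ≤ E)
    (he : ∀ t, E ≤ t → |r t| ≤ e) (he2 : e ≤ 1 / 4)
    (hu : 1 ≤ u) (hq : 0 < q) (hqα : q ^ α = 1 / u ^ 2) (n : ℕ) (hn : 0 < n) :
    P.real {ω | ∀ j < n, X (j * q) ω ≤ u} ≤
      60 * (∑' k : ℕ, Real.exp (-(C / 8) * (k:ℝ) ^ α)) / (n * Psi u) +
      2 * (E / q + 1) * Real.exp (-u ^ 2 / (1 + ρ)) / (n * Psi u * Psi u) +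
      ((Psi u * Psi (u - 2 * e * u) + Psi (2 * u)) / Psi u ^ 2 - 1) := by
  set S := ∑' k : ℕ, Real.exp (-(C / 8) * (k:ℝ) ^ α) with hS
  set M := Real.exp (-u ^ 2 / (1 + ρ)) with hM
  set F := Psi u * Psi (u - 2 * e * u) + Psi (2 * u) with hF
  have hp := Psi_pos hu
  set p := Psi u with hpd
  have hn0 : (0:ℝ) < n := by exact_mod_cast hn
  have hsm := second_moment (P := P) (fun j : ℕ => {ω | u < X (j * q) ω})
    (fun j => (hG.aem (show 0 ≤ (j:ℝ) * q by positivity)).nullMeasurableSet_preimage measurableSet_Ioi)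
    n p (fun j => hG.tail hr0 (by positivity) u)
  have hset : {ω | ∀ j < n, ω ∉ {ω | u < X ((j:ℝ) * q) ω}} = {ω | ∀ j < n, X ((j:ℝ) * q) ω ≤ u} := by
    ext ω; simp
  rw [hset] at hsm
  have hrow : ∀ i ∈ Finset.range n, ∑ j ∈ Finset.range n,
      P.real ({ω | u < X (i * q) ω} ∩ {ω | u < X (j * q) ω}) ≤
      60 * p * S + 2 * ((E / q + 1) * M) + n * F := by
    intro i hi
    refine (Finset.sum_le_sum fun j _ => hG.pair_all hr0 hα hC hloc hρ0 hρ he he2 hu hq hqα i j).trans ?_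
    rw [Finset.sum_add_distrib, Finset.sum_add_distrib, Finset.sum_const, Finset.card_range,
      nsmul_eq_mul]
    have h1 := sum_ndist (fun k => 30 * Psi u * Real.exp (-(C / 8) * (k : ℝ) ^ α))
      (fun k => by positivity) n i (Finset.mem_range.1 hi)
    have h2 := sum_ndist (fun k => if (k : ℝ) * q ≤ E then M else 0)
      (fun k => by split_ifs <;> positivity) n i (Finset.mem_range.1 hi)
    have h3 := sum_mid hq hE (Real.exp_pos _ : 0 < M).le n
    have h4 : ∑ k ∈ Finset.range n, 30 * p * Real.exp (-(C / 8) * (k : ℝ) ^ α) ≤ 30 * p * S := by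
      rw [← Finset.mul_sum]
      gcongr
      exact (summable_near hα hC).sum_le_tsum _ fun k _ => by positivity
    gcongr ?_ + ?_ + _
    · linarith
    · linarith
  have htot := Finset.sum_le_sum hrow
  rw [Finset.sum_const, Finset.card_range, nsmul_eq_mul] at htot
  have h5 : (n * p) ^ 2 * P.real {ω | ∀ j < n, X (j * q) ω ≤ u} ≤
      n * (60 * p * S + 2 * ((E / q + 1) * M) + n * F) - (n * p) ^ 2 := hsm.trans (by gcongr)
  have h6 : P.real {ω | ∀ j < n, X (j * q) ω ≤ u} ≤
      (n * (60 * p * S + 2 * ((E / q + 1) * M) + n * F) - (n * p) ^ 2) / (n * p) ^ 2 := by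
    rw [le_div_iff₀ (by positivity)]; linarith
  refine h6.trans (le_of_eq ?_)
  field_simp
  ring
end E


set_option linter.unusedSectionVars false

lemma r_tendsto_zero {r : ℝ → ℝ} (hA3 : Tendsto (fun t => r t * Real.log t) atTop (𝓝 0)) :
    Tendsto r atTop (𝓝 0) := by
  have h := hA3.mul (tendsto_inv_atTop_zero.comp Real.tendsto_log_atTop)
  rw [zero_mul] at h
  refine h.congr' ?_
  filter_upwards [eventually_gt_atTop 1] with t ht
  have := (Real.log_pos ht).ne'
  simp only [Function.comp]; field_simp

lemma r_far {r : ℝ → ℝ} (hA3 : Tendsto (fun t => r t * Real.log t) atTop (𝓝 0)) {η e : ℝ}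
    (hη : 0 < η) (he : 0 < e) :
    ∀ᶠ u : ℝ in atTop, ∀ t, Real.exp (η * u ^ 2) ≤ t → |r t| ≤ e / u ^ 2 := by
  have h1 : ∀ᶠ t in atTop, |r t * Real.log t| < e * η := by
    have := (hA3.abs).eventually (gt_mem_nhds (show |(0:ℝ)| < e * η by simpa using by positivity))
    exact this
  obtain ⟨t0, ht0⟩ := eventually_atTop.1 h1
  have h2 : Tendsto (fun u : ℝ => Real.exp (η * u ^ 2)) atTop atTop :=
    Real.tendsto_exp_atTop.comp ((tendsto_pow_atTop (by norm_num)).const_mul_atTop hη)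
  filter_upwards [h2.eventually_ge_atTop t0, eventually_gt_atTop 0] with u hu hu0 t ht
  have h3 := ht0 t (hu.trans ht)
  have h4 : η * u ^ 2 ≤ Real.log t := by
    rw [Real.le_log_iff_exp_le ((Real.exp_pos _).trans_le ht)]; exact ht
  have h5 : 0 < η * u ^ 2 := by positivity
  rw [abs_mul, abs_of_pos (h5.trans_le h4)] at h3
  rw [le_div_iff₀ (by positivity)]
  have h6 : |r t| * (η * u ^ 2) ≤ |r t| * Real.log t := by gcongr
  have h7 : η * (|r t| * u ^ 2) ≤ η * e := by linarith
  exact le_of_mul_le_mul_left h7 hη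

lemma term3_bound {e1 u : ℝ} (he : 0 < e1) (he2 : e1 ≤ 1 / 2) (hu : 2 ≤ u) :
    (Psi u * Psi (u - 2 * (e1 / u ^ 2) * u) + Psi (2 * u)) / Psi u ^ 2 - 1 ≤
      180 * e1 + 450 * (u * Real.exp (-u ^ 2)) := by
  have hu0 : 0 < u := by linarith
  have hp := Psi_pos (show 1 ≤ u by linarith)
  have hg := Psi_ge (show 1 ≤ u by linarith)
  have hh : 2 * (e1 / u ^ 2) * u = 2 * e1 / u := by field_simp
  rw [hh]
  have hh0 : 0 ≤ 2 * e1 / u := by positivity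
  have hh1 : 2 * e1 / u ≤ u := by rw [div_le_iff₀ hu0]; nlinarith
  have h1 := Psi_shift hh0 hh1
  have h2 : Real.exp (-(u - 2 * e1 / u) ^ 2 / 2) ≤ Real.exp (-u ^ 2 / 2) * 3 := by
    have : Real.exp (-(u - 2 * e1 / u) ^ 2 / 2) ≤ Real.exp (-u ^ 2 / 2) * Real.exp 1 := by
      rw [← Real.exp_add]
      apply Real.exp_le_exp.2
      have e1' : (u - 2 * e1 / u) ^ 2 = u ^ 2 - 4 * e1 + (2 * e1 / u) ^ 2 := by field_simp; ring
      rw [e1']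
      nlinarith [sq_nonneg (2 * e1 / u)]
    have h3 : Real.exp 1 ≤ 3 := by have := Real.exp_one_lt_d9; linarith
    exact this.trans (by gcongr)
  have h3 : Psi (u - 2 * e1 / u) ≤ Psi u * (1 + 180 * e1) := by
    have h4 : 2 * e1 / u * Real.exp (-(u - 2 * e1 / u) ^ 2 / 2) ≤
        2 * e1 / u * (Real.exp (-u ^ 2 / 2) * 3) := by gcongr
    have h5 : 2 * e1 / u * (Real.exp (-u ^ 2 / 2) * 3) =
        180 * e1 * (Real.exp (-u ^ 2 / 2) / u / 30) := by field_simp; ring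
    have h6 : 180 * e1 * (Real.exp (-u ^ 2 / 2) / u / 30) ≤ 180 * e1 * Psi u := by gcongr
    linarith
  have h4 : Psi (2 * u) ≤ 450 * (u * Real.exp (-u ^ 2)) * Psi u ^ 2 := by
    have h5 := Psi_le (show 0 < 2 * u by linarith)
    have h6 : (Real.exp (-u ^ 2 / 2) / u / 30) ^ 2 ≤ Psi u ^ 2 := by gcongr
    have h7 : Real.exp (-(2 * u) ^ 2 / 2) / (2 * u) =
        450 * (u * Real.exp (-u ^ 2)) * (Real.exp (-u ^ 2 / 2) / u / 30) ^ 2 := by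
      have : Real.exp (-(2 * u) ^ 2 / 2) = Real.exp (-u ^ 2) * Real.exp (-u ^ 2 / 2) ^ 2 := by
        rw [← Real.exp_nat_mul, ← Real.exp_add]; congr 1; push_cast; ring
      rw [this]; field_simp; norm_num
    rw [h7] at h5
    exact h5.trans (by gcongr)
  rw [sub_le_iff_le_add, div_le_iff₀ (by positivity)]
  have h5 : Psi u * Psi (u - 2 * e1 / u) ≤ Psi u * (Psi u * (1 + 180 * e1)) := by gcongr
  nlinarith

lemma exp_sq_small {β η : ℝ} (hη : 0 < η) :
    Tendsto (fun u : ℝ => u ^ β * Real.exp (-(η * u ^ 2))) atTop (𝓝 0) := by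
  refine tendsto_of_tendsto_of_tendsto_of_le_of_le' tendsto_const_nhds
    (tendsto_rpow_mul_exp_neg_mul_atTop_nhds_zero β η hη) ?_ ?_
  · filter_upwards [eventually_gt_atTop 0] with u hu
    have := Real.rpow_pos_of_pos hu β; positivity
  · filter_upwards [eventually_ge_atTop 1] with u hu
    have := Real.rpow_pos_of_pos (show 0 < u by linarith) β
    gcongr
    nlinarith [mul_pos hη (show 0 < u by linarith)]

lemma mscale_eq {α u : ℝ} (hα : 0 < α) (hu : 0 < u) :
    u * Real.exp (u ^ 2 / 2) * u ^ (-(2 / α)) = mscale α u := by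
  unfold mscale
  have h1 : u ^ ((α - 2) / α) = u * u ^ (-(2 / α)) := by
    nth_rewrite 2 [← Real.rpow_one u]
    rw [← Real.rpow_add hu]; congr 1; field_simp; ring
  rw [h1]; ring

lemma mscale_tendsto {α : ℝ} (hα : 0 < α) : Tendsto (mscale α) atTop atTop := by
  have h := (exp_sq_small (β := -((α - 2) / α)) (η := 1 / 2) (by norm_num))
  have h1 : Tendsto (fun u => (mscale α u)⁻¹) atTop (𝓝[>] 0) := by
    refine tendsto_nhdsWithin_iff.2 ⟨h.congr' ?_, ?_⟩
    · filter_upwards [eventually_gt_atTop 0] with u hu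
      unfold mscale
      rw [mul_inv, ← Real.rpow_neg hu.le, ← Real.exp_neg]
      congr 2; ring
    · filter_upwards [eventually_gt_atTop 0] with u hu
      exact inv_pos.2 (mscale_pos hu)
  exact h1.inv_tendsto_nhdsGT_zero.congr (fun u => by simp)

section F
variable {Ω : Type*} [MeasurableSpace Ω] {P : Measure Ω} [IsProbabilityMeasure P]
  {X : ℝ → Ω → ℝ} {r : ℝ → ℝ}

lemma GP.lower_main (hG : GP P X r) (hr0 : r 0 = 1)
    (hcont : ∀ᵐ ω ∂P, ContinuousOn (fun t => X t ω) (Ici 0))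
    {C α δ : ℝ} (hα : 0 < α) (hC : 0 < C) (hδ : 0 < δ)
    (hloc : ∀ τ, 0 < τ → τ ≤ δ → 0 ≤ r τ ∧ r τ ≤ 1 ∧ 1 - r τ ≤ 2 * C * τ ^ α ∧
      C / 2 * τ ^ α ≤ 1 - r τ)
    (hA2 : ∀ t : ℝ, 0 < t → r t < 1)
    (hA3 : Tendsto (fun t => r t * Real.log t) atTop (𝓝 0)) {ε : ℝ} (hε : 0 < ε) :
    ∃ A, 0 < A ∧ ∀ᶠ u in atTop, ∃ n : ℕ, ∃ q : ℝ, 0 ≤ q ∧ n * q ≤ A * mscale α u ∧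
      P.real {ω | ∀ j < n, X (j * q) ω ≤ u} ≤ ε := by
  obtain ⟨ρ, hρ0, hρ1, hρ⟩ := hG.r_bound hcont hr0 hA2 (r_tendsto_zero hA3) hδ
  set S := ∑' k : ℕ, Real.exp (-(C / 8) * (k:ℝ) ^ α) with hS
  have hS0 : 0 ≤ S := tsum_nonneg fun k => by positivity
  set A := 14400 * S / ε + 1 with hA
  have hA0 : 0 < A := by positivity
  set η := (1 / (1 + ρ) - 1 / 2) / 2 with hηd
  have hη : 0 < η := by
    have : 1 / 2 < 1 / (1 + ρ) := by
      rw [div_lt_div_iff₀ (by norm_num) (by linarith)]; linarith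
    rw [hηd]; linarith
  set e1 := min (1 / 2) (ε / 720) with he1
  have he0 : 0 < e1 := by rw [he1]; positivity
  have he2 : e1 ≤ 1 / 2 := min_le_left _ _
  have he3 : e1 ≤ ε / 720 := min_le_right _ _
  refine ⟨A, hA0, ?_⟩
  have hl2 := (exp_sq_small (β := 2 / α + 1) hη).const_mul (7200 / A)
  have hl3 := (exp_sq_small (β := 1) (η := 1) one_pos).const_mul 450
  rw [mul_zero] at hl2 hl3
  have hD : Tendsto (fun u : ℝ => A * (u * Real.exp (u ^ 2 / 2))) atTop atTop := by
    refine Tendsto.const_mul_atTop hA0 (tendsto_id.atTop_mul_atTop₀ ?_)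
    exact Real.tendsto_exp_atTop.comp ((tendsto_pow_atTop (by norm_num)).atTop_div_const two_pos)
  filter_upwards [eventually_ge_atTop 2, r_far hA3 hη he0,
    hl2.eventually (gt_mem_nhds (show 0 < ε / 4 by positivity)),
    hl3.eventually (gt_mem_nhds (show 0 < ε / 4 by positivity)),
    hD.eventually_ge_atTop 2] with u hu hfar ht2 ht3 hD2
  have hu0 : 0 < u := by linarith
  set D := u * Real.exp (u ^ 2 / 2) with hDd
  have hD0 : 0 < D := by positivity
  set q := u ^ (-(2 / α)) with hq
  have hq0 : 0 < q := Real.rpow_pos_of_pos hu0 _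
  have hqα : q ^ α = 1 / u ^ 2 := by
    rw [hq, ← Real.rpow_mul hu0.le]
    have : -(2 / α) * α = -(2:ℕ) := by field_simp; norm_num
    rw [this, Real.rpow_neg hu0.le, Real.rpow_natCast, one_div]
  set n := ⌊A * D⌋₊ with hn
  have hn1 : (n:ℝ) ≤ A * D := Nat.floor_le (by positivity)
  have hn2 : A * D / 2 ≤ n := by
    have := Nat.lt_floor_add_one (A * D)
    rw [← hn] at this; linarith
  have hn0 : (0:ℝ) < n := by linarith [mul_pos hA0 hD0]
  refine ⟨n, q, hq0.le, ?_, ?_⟩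
  · rw [← mscale_eq hα hu0, ← hDd, ← hq, ← mul_assoc]; gcongr
  have hb := hG.no_exceed_bound (E := Real.exp (η * u ^ 2)) (e := e1 / u ^ 2) hr0 hα hC hloc hρ0 hρ
    (Real.exp_pos _).le hfar (by rw [div_le_iff₀ (by positivity)]; nlinarith) (by linarith) hq0 hqα n
    (by exact_mod_cast hn0)
  refine hb.trans ?_
  have h3 := term3_bound he0 he2 hu
  rw [← hS]
  have hp := Psi_pos (show 1 ≤ u by linarith)
  have hpD : 1 / (30 * D) ≤ Psi u := by
    refine le_trans (le_of_eq ?_) (Psi_ge (show 1 ≤ u by linarith))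
    rw [hDd, neg_div, Real.exp_neg]; field_simp
  have hnp : A / 60 ≤ n * Psi u := by
    calc A / 60 = (A * D / 2) * (1 / (30 * D)) := by field_simp; norm_num
      _ ≤ _ := by gcongr
  have t1 : 60 * S / (n * Psi u) ≤ ε / 4 := by
    calc 60 * S / (n * Psi u) ≤ 60 * S / (A / 60) := by gcongr
      _ = 3600 * S / A := by field_simp; ring
      _ ≤ ε / 4 := by
        rw [div_le_iff₀ hA0, hA]
        have : ε / 4 * (14400 * S / ε + 1) = 3600 * S + ε / 4 := by field_simp; ring
        rw [this]; linarith
  have t2 : 2 * (Real.exp (η * u ^ 2) / q + 1) * Real.exp (-u ^ 2 / (1 + ρ)) /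
      (n * Psi u * Psi u) ≤ ε / 4 := by
    refine le_trans ?_ ht2.le
    have hqi : Real.exp (η * u ^ 2) / q = Real.exp (η * u ^ 2) * u ^ (2 / α) := by
      rw [hq, Real.rpow_neg hu0.le]; field_simp
    have hge : 1 ≤ Real.exp (η * u ^ 2) * u ^ (2 / α) := by
      have a1 : 1 ≤ Real.exp (η * u ^ 2) := Real.one_le_exp (by positivity)
      have a2 : 1 ≤ u ^ (2 / α) := Real.one_le_rpow (by linarith) (by positivity)
      nlinarith
    rw [hqi]
    calc 2 * (Real.exp (η * u ^ 2) * u ^ (2 / α) + 1) * Real.exp (-u ^ 2 / (1 + ρ)) / (n * Psi u * Psi u)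
        ≤ 2 * (Real.exp (η * u ^ 2) * u ^ (2 / α) + Real.exp (η * u ^ 2) * u ^ (2 / α)) *
          Real.exp (-u ^ 2 / (1 + ρ)) / ((A / 60) * (1 / (30 * D))) := by gcongr
      _ = 7200 / A * (u ^ (2 / α) * u * (Real.exp (η * u ^ 2) * Real.exp (-u ^ 2 / (1 + ρ)) *
          Real.exp (u ^ 2 / 2))) := by rw [hDd]; field_simp; norm_num
      _ = 7200 / A * (u ^ (2 / α + 1) * Real.exp (-(η * u ^ 2))) := by
        rw [Real.rpow_add hu0, Real.rpow_one, ← Real.exp_add, ← Real.exp_add]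
        congr 4
        have : 1 + ρ ≠ 0 := by positivity
        have h9 : -u ^ 2 / (1 + ρ) = -u ^ 2 * (1 / (1 + ρ)) := by ring
        have h10 : 1 / (1 + ρ) = 2 * η + 1 / 2 := by rw [hηd]; ring
        rw [h9, h10]; ring
  have t3 : 450 * (u * Real.exp (-u ^ 2)) < ε / 4 := by simpa using ht3
  linarith
end F


set_option linter.unusedSectionVars false

lemma slow_pos {L : ℝ → ℝ} (hanti : ∀ s t, 0 < s → s ≤ t → L t ≤ L s) (h0 : ∀ t, 0 < t → 0 ≤ L t)
    (hL : ∀ c : ℝ, 0 < c → Tendsto (fun t => L (c * t) / L t) atTop (𝓝 1)) :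
    ∀ t, 0 < t → 0 < L t := by
  intro t ht
  have h1 := (hL 1 one_pos).eventually (lt_mem_nhds (show (0:ℝ) < 1 by norm_num))
  obtain ⟨s, hs, hst⟩ := (h1.and (eventually_ge_atTop t)).exists
  have hne : L s ≠ 0 := by
    intro h; rw [h] at hs; simp at hs
  exact (lt_of_le_of_ne (h0 s (ht.trans_le hst)) hne.symm).trans_le (hanti t s ht hst)

lemma slow_sum {L : ℝ → ℝ} (hanti : ∀ s t, 0 < s → s ≤ t → L t ≤ L s) (hpos : ∀ t, 0 < t → 0 < L t)
    (h1 : ∀ t, 0 < t → L t ≤ 1)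
    (hL : ∀ c : ℝ, 0 < c → Tendsto (fun t => L (c * t) / L t) atTop (𝓝 1)) :
    ∃ M, 0 < M ∧ ∀ n : ℕ, 1 ≤ n → ∑ k ∈ Finset.range n, L (k + 1) ≤ M * n * L n := by
  have hev := (hL (1 / 3) (by norm_num)).eventually (gt_mem_nhds (show (1:ℝ) < 5 / 4 by norm_num))
  obtain ⟨t0, ht0⟩ := eventually_atTop.1 hev
  obtain ⟨n0, hn0⟩ := exists_nat_gt (max t0 2)
  have hn0t : t0 < n0 := (le_max_left _ _).trans_lt hn0
  have hn02 : (2:ℝ) < n0 := (le_max_right _ _).trans_lt hn0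
  have hLn0 := hpos n0 (by linarith)
  set M := max 2 (1 / L n0) with hM
  have hM2 : 2 ≤ M := le_max_left _ _
  have hM3 : 1 ≤ M * L n0 := by
    have : 1 / L n0 ≤ M := le_max_right _ _
    rwa [div_le_iff₀ hLn0] at this
  refine ⟨M, by linarith, ?_⟩
  intro n
  induction n using Nat.strong_induction_on with
  | _ n ih =>
  intro hn
  have hn1 : (1:ℝ) ≤ n := by exact_mod_cast hn
  by_cases hle : n ≤ n0
  · have a1 : ∑ k ∈ Finset.range n, L (k + 1) ≤ n := by
      calc ∑ k ∈ Finset.range n, L (k + 1) ≤ ∑ k ∈ Finset.range n, (1:ℝ) :=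
            Finset.sum_le_sum fun k _ => h1 _ (by positivity)
        _ = n := by simp
    have a2 : L n0 ≤ L n := hanti _ _ (by linarith) (by exact_mod_cast hle)
    have a3 : M * L n0 ≤ M * L n := by gcongr
    nlinarith
  · push Not at hle
    have hlt : (n0:ℝ) < n := by exact_mod_cast hle
    have hn0' : 2 < n0 := by exact_mod_cast hn02
    set m := n / 2 with hm
    have hm1 : 1 ≤ m := by omega
    have hm1' : (1:ℝ) ≤ m := by exact_mod_cast hm1
    have hmn : m < n := by omega
    have hmn2 : (m:ℝ) ≤ n / 2 := by
      rw [le_div_iff₀ two_pos]; exact_mod_cast (show m * 2 ≤ n by omega)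
    have hmn3 : (n:ℝ) / 3 ≤ m := by
      rw [div_le_iff₀ (by norm_num)]; exact_mod_cast (show n ≤ m * 3 by omega)
    have hLn := hpos n (by linarith)
    have hLm : L m ≤ 5 / 4 * L n := by
      have a1 := ht0 n (by linarith)
      rw [div_lt_iff₀ hLn] at a1
      have a2 := hanti (1 / 3 * n) m (by linarith) (by linarith)
      linarith
    have hsplit : ∑ k ∈ Finset.range n, L (k + 1) =
        ∑ k ∈ Finset.range m, L (k + 1) + ∑ k ∈ Finset.Ico m n, L (k + 1) :=
      (Finset.sum_range_add_sum_Ico _ hmn.le).symm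
    have hb : ∑ k ∈ Finset.Ico m n, L ((k:ℝ) + 1) ≤ (n - m) * L m := by
      calc ∑ k ∈ Finset.Ico m n, L ((k:ℝ) + 1) ≤ ∑ k ∈ Finset.Ico m n, L m := by
            refine Finset.sum_le_sum fun k hk => hanti _ _ (by linarith) ?_
            have : (m:ℝ) ≤ k := by exact_mod_cast (Finset.mem_Ico.1 hk).1
            linarith
        _ = (n - m) * L m := by
            rw [Finset.sum_const, Nat.card_Ico, nsmul_eq_mul, Nat.cast_sub hmn.le]
    have hc := ih m hmn hm1
    rw [hsplit]
    have hd : M * m * L m + (n - m) * L m ≤ (M * m + (n - m)) * (5 / 4 * L n) := by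
      rw [← add_mul]
      have : 0 ≤ M * m + (n - m) := by nlinarith
      gcongr
    have he : (M * m + (n - m)) * (5 / 4) ≤ M * n := by nlinarith
    have hf : (M * m + (n - m)) * (5 / 4) * L n ≤ M * n * L n := by gcongr
    linarith

lemma slow_sum' {L : ℝ → ℝ} (hanti : ∀ s t, 0 < s → s ≤ t → L t ≤ L s) (hpos : ∀ t, 0 < t → 0 < L t)
    (h1 : ∀ t, 0 < t → L t ≤ 1)
    (hL : ∀ c : ℝ, 0 < c → Tendsto (fun t => L (c * t) / L t) atTop (𝓝 1)) :
    ∃ M, 0 < M ∧ ∀ t : ℝ, 2 ≤ t → 2 + ∑ k ∈ Finset.range ⌊t⌋₊, L (k + 1) ≤ M * t * L (t / 2) := by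
  obtain ⟨M, hM, h⟩ := slow_sum hanti hpos h1 hL
  have hL1 := hpos 1 one_pos
  refine ⟨(2 / L 1 + 1) * M, by positivity, fun t ht => ?_⟩
  have hn : 1 ≤ ⌊t⌋₊ := Nat.le_floor (by push_cast; linarith)
  have a1 := h _ hn
  have a2 : L 1 ≤ ∑ k ∈ Finset.range ⌊t⌋₊, L ((k:ℝ) + 1) := by
    have := Finset.single_le_sum (f := fun k : ℕ => L ((k:ℝ) + 1))
      (fun k _ => (hpos _ (by positivity)).le) (Finset.mem_range.2 hn)
    simpa using this
  have a3 := Nat.floor_le (show 0 ≤ t by linarith)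
  have a4 := Nat.lt_floor_add_one t
  have a5 : L ⌊t⌋₊ ≤ L (t / 2) := hanti _ _ (by linarith) (by linarith)
  have a6 : M * ⌊t⌋₊ * L ⌊t⌋₊ ≤ M * t * L (t / 2) := by
    have := hpos ⌊t⌋₊ (by linarith)
    gcongr
  set Q := ∑ k ∈ Finset.range ⌊t⌋₊, L ((k:ℝ) + 1)
  have a7 : 2 ≤ 2 / L 1 * Q := by
    rw [div_mul_eq_mul_div, le_div_iff₀ hL1]; linarith
  calc 2 + Q ≤ (2 / L 1 + 1) * Q := by linarith
    _ ≤ (2 / L 1 + 1) * (M * t * L (t / 2)) := by gcongr; linarith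
    _ = _ := by ring

section G
variable {Ω : Type*} [MeasurableSpace Ω] {P : Measure Ω} [IsProbabilityMeasure P]
  {X : ℝ → Ω → ℝ} {T : Ω → ℝ}

lemma rat_exceed {f : ℝ → ℝ} (hf : ContinuousOn f (Ici 0)) {s u : ℝ} {k : ℕ}
    (hs : s ∈ Icc (k:ℝ) (k + 1)) (hu : u < f s) :
    ∃ q : ℚ, (q:ℝ) ∈ Icc (k:ℝ) (k + 1) ∧ u < f q := by
  have hk : (0:ℝ) ≤ k := by positivity
  have h1 : ∀ᶠ t in 𝓝[Ici 0] s, u < f t :=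
    (hf s (hk.trans hs.1)).eventually (lt_mem_nhds hu)
  obtain ⟨V, hV, hsV, hVs⟩ := mem_nhdsWithin.1 h1
  have hcl : s ∈ closure (Ioo (k:ℝ) (k + 1)) := by
    rw [closure_Ioo (by linarith)]; exact hs
  obtain ⟨y, hy1, hy2⟩ := mem_closure_iff.1 hcl V hV hsV
  obtain ⟨q, hq⟩ := Rat.denseRange_cast (𝕜 := ℝ) |>.exists_mem_open (hV.inter isOpen_Ioo) ⟨y, hy1, hy2⟩
  exact ⟨q, ⟨hq.2.1.le, hq.2.2.le⟩, hVs ⟨hq.1, hk.trans hq.2.1.le⟩⟩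

lemma upper_bound (hcont : ∀ᵐ ω ∂P, ContinuousOn (fun t => X t ω) (Ici 0))
    (hT0 : ∀ ω, 0 ≤ T ω) (hindep : IndepFun T (fun ω t => X t ω) P) {u κ b : ℝ} (hκ : 0 ≤ κ)
    (hb : 0 ≤ b)
    (hK : ∀ k : ℕ, P {ω | ∃ t ∈ Icc (k:ℝ) (k + 1), u < X t ω} ≤ ENNReal.ofReal κ) :
    P.real {ω | u < sSup ((fun s => X s ω) '' Icc 0 (T ω))} ≤
      P.real {ω | b < T ω} + κ * ∑ k ∈ Finset.range (⌊b⌋₊ + 1), P.real {ω | (k:ℝ) ≤ T ω} := by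
  set B : ℕ → Set (ℝ → ℝ) := fun k => {x | ∃ q : ℚ, (q:ℝ) ∈ Icc (k:ℝ) (k + 1) ∧ u < x q} with hB
  have hBm : ∀ k, MeasurableSet (B k) := by
    intro k
    have : B k = ⋃ q : ℚ, ⋃ (_ : (q:ℝ) ∈ Icc (k:ℝ) (k + 1)), {x : ℝ → ℝ | u < x q} := by
      ext x; simp [hB]
    rw [this]
    exact MeasurableSet.iUnion fun q => MeasurableSet.iUnion fun _ =>
      measurableSet_lt measurable_const (measurable_pi_apply _)
  set Z : Ω → (ℝ → ℝ) := fun ω t => X t ω with hZ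
  have hsub : {ω | u < sSup ((fun s => X s ω) '' Icc 0 (T ω))} ≤ᵐ[P]
      ({ω | b < T ω} ∪ ⋃ k ∈ Finset.range (⌊b⌋₊ + 1), (T ⁻¹' Ici (k:ℝ) ∩ Z ⁻¹' B k) : Set Ω) := by
    filter_upwards [hcont] with ω hω hu
    change u < sSup ((fun s => X s ω) '' Icc 0 (T ω)) at hu
    obtain ⟨_, ⟨s, hs, rfl⟩, hus⟩ := exists_lt_of_lt_csSup
      ((nonempty_Icc.2 (hT0 ω)).image (fun s => X s ω)) hu
    by_cases hbT : b < T ω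
    · exact Or.inl hbT
    · push Not at hbT
      right
      have f1 := Nat.floor_le hs.1
      have f2 := Nat.lt_floor_add_one s
      refine mem_iUnion₂.2 ⟨⌊s⌋₊, ?_, ?_, ?_⟩
      · rw [Finset.mem_range]
        exact Nat.lt_succ_of_le (Nat.floor_le_floor (hs.2.trans hbT))
      · exact f1.trans hs.2
      · exact rat_exceed hω ⟨f1, f2.le⟩ hus
  have hk : ∀ k : ℕ, P.real (T ⁻¹' Ici (k:ℝ) ∩ Z ⁻¹' B k) ≤ κ * P.real {ω | (k:ℝ) ≤ T ω} := by
    intro k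
    have h1 := hindep.measure_inter_preimage_eq_mul (Ici (k:ℝ)) (B k) measurableSet_Ici (hBm k)
    have h2 : P.real (Z ⁻¹' B k) ≤ κ := by
      refine ENNReal.toReal_le_of_le_ofReal hκ (le_trans (measure_mono ?_) (hK k))
      rintro ω ⟨q, hq, hqu⟩
      exact ⟨q, hq, hqu⟩
    rw [measureReal_def, h1, ENNReal.toReal_mul, mul_comm]
    exact mul_le_mul_of_nonneg_right h2 ENNReal.toReal_nonneg
  have h1 : P.real {ω | u < sSup ((fun s => X s ω) '' Icc 0 (T ω))} ≤ P.real
      ({ω | b < T ω} ∪ ⋃ k ∈ Finset.range (⌊b⌋₊ + 1), (T ⁻¹' Ici (k:ℝ) ∩ Z ⁻¹' B k) : Set Ω) :=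
    ENNReal.toReal_mono (measure_ne_top _ _) (measure_mono_ae hsub)
  refine h1.trans ((measureReal_union_le _ _).trans ?_)
  gcongr
  rw [Finset.mul_sum]
  exact (measureReal_biUnion_finset_le _ _).trans (Finset.sum_le_sum fun k _ => hk k)

lemma lower_bound (hcont : ∀ᵐ ω ∂P, ContinuousOn (fun t => X t ω) (Ici 0))
    (hindep : IndepFun T (fun ω t => X t ω) P) {u b q ε : ℝ} {n : ℕ} (hq : 0 ≤ q)
    (hnq : n * q ≤ b) (hε : P.real {ω | ∀ j < n, X (j * q) ω ≤ u} ≤ ε) :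
    P.real {ω | b < T ω} * (1 - ε) ≤ P.real {ω | u < sSup ((fun s => X s ω) '' Icc 0 (T ω))} := by
  set B : Set (ℝ → ℝ) := {x | ∃ j : ℕ, j < n ∧ u < x (j * q)} with hB
  have hBm : MeasurableSet B := by
    have : B = ⋃ j : ℕ, ⋃ (_ : j < n), {x : ℝ → ℝ | u < x (j * q)} := by
      ext x; simp [hB]
    rw [this]
    exact MeasurableSet.iUnion fun q => MeasurableSet.iUnion fun _ =>
      measurableSet_lt measurable_const (measurable_pi_apply _)
  set Z : Ω → (ℝ → ℝ) := fun ω t => X t ω with hZ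
  have h1 := hindep.measure_inter_preimage_eq_mul (Ioi b) B measurableSet_Ioi hBm
  have hsub : (T ⁻¹' Ioi b ∩ Z ⁻¹' B : Set Ω) ≤ᵐ[P]
      {ω | u < sSup ((fun s => X s ω) '' Icc 0 (T ω))} := by
    filter_upwards [hcont] with ω hω hu
    obtain ⟨hu1, j, hj, hju⟩ := hu
    change b < T ω at hu1
    change u < sSup ((fun s => X s ω) '' Icc 0 (T ω))
    have hjn : (j:ℝ) * q ≤ n * q := by gcongr
    refine lt_csSup_of_lt ?_ ⟨(j:ℝ) * q, ⟨by positivity, by linarith⟩, rfl⟩ hju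
    exact (isCompact_Icc.image_of_continuousOn (hω.mono Icc_subset_Ici_self)).bddAbove
  have h2 : P.real (T ⁻¹' Ioi b ∩ Z ⁻¹' B : Set Ω) ≤
      P.real {ω | u < sSup ((fun s => X s ω) '' Icc 0 (T ω))} :=
    ENNReal.toReal_mono (measure_ne_top _ _) (measure_mono_ae hsub)
  refine le_trans ?_ h2
  rw [measureReal_def P (_ ∩ _), h1, ENNReal.toReal_mul]
  refine mul_le_mul_of_nonneg_left ?_ ENNReal.toReal_nonneg
  have h3 : P.real univ ≤ P.real (Z ⁻¹' B) + P.real {ω | ∀ j < n, X (j * q) ω ≤ u} := by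
    refine (measureReal_mono ?_).trans (measureReal_union_le _ _)
    intro ω _
    by_cases h : ∃ j : ℕ, j < n ∧ u < X (j * q) ω
    · exact Or.inl h
    · right; push Not at h; exact h
  rw [probReal_univ] at h3
  change 1 - ε ≤ P.real (Z ⁻¹' B)
  linarith
end G


theorem supremum_over_random_interval_slowly_varying_T
    {Ω : Type*} [MeasurableSpace Ω] (P : Measure Ω) [IsProbabilityMeasure P]
    (X : ℝ → Ω → ℝ) (r : ℝ → ℝ) (C α : ℝ)
    (hα : 0 < α) (hα2 : α ≤ 2) (hC : 0 < C)
    -- centered stationary Gaussian process with covariance function r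
    (hGauss : ∀ (n : ℕ) (c : Fin n → ℝ) (t : Fin n → ℝ), (∀ i, 0 ≤ t i) →
      Measure.map (fun ω => ∑ i, c i * X (t i) ω) P
        = gaussianReal 0 (Real.toNNReal (∑ i, ∑ j, c i * c j * r (|t i - t j|))))
    -- a.s. continuous sample paths
    (hcont : ∀ᵐ ω ∂P, ContinuousOn (fun t => X t ω) (Ici 0))
    -- (A1)
    (hA1 : (fun t => r t - (1 - C * |t| ^ α)) =o[𝓝[>] (0:ℝ)] fun t => |t| ^ α)
    -- (A2)
    (hA2 : ∀ t : ℝ, 0 < t → r t < 1)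
    -- (A3)
    (hA3 : Tendsto (fun t => r t * Real.log t) atTop (𝓝 0))
    -- the random horizon T : nonnegative, independent of X
    (T : Ω → ℝ) (hT0 : ∀ ω, 0 ≤ T ω) (hTmeas : Measurable T)
    (hindep : IndepFun T (fun ω t => X t ω) P)
    -- slowly varying tail
    (L : ℝ → ℝ)
    (hL : ∀ c : ℝ, 0 < c → Tendsto (fun t => L (c * t) / L t) atTop (𝓝 1))
    (htail : ∀ t : ℝ, 0 < t → (P {ω | t < T ω}).toReal = L t)
    :
    Tendsto (fun u =>
        (P {ω | u < sSup ((fun s => X s ω) '' Icc 0 (T ω))}).toReal /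
          L (u ^ ((α - 2)/α) * Real.exp (u^2/2)))
      atTop (𝓝 1) := by
  have hG : GP P X r := hGauss
  obtain ⟨δ, hδ, hloc⟩ := r_local hα hC hA1
  have hr0 : r 0 = 1 := hG.r0 hcont (r_tendsto_one hα hC hA1)
  obtain ⟨K, hK, hunit⟩ := hG.unit_interval hr0 hcont hα hC hδ hloc
  have htail' : ∀ t : ℝ, 0 < t → P.real {ω | t < T ω} = L t := htail
  have hanti : ∀ s t, 0 < s → s ≤ t → L t ≤ L s := by
    intro s t hs hst
    rw [← htail' s hs, ← htail' t (hs.trans_le hst)]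
    exact measureReal_mono fun ω (hω : t < T ω) => hst.trans_lt hω
  have h1 : ∀ t, 0 < t → L t ≤ 1 := fun t ht => by
    rw [← htail' t ht]; exact measureReal_le_one
  have hpos := slow_pos hanti (fun t ht => by rw [← htail' t ht]; exact measureReal_nonneg) hL
  obtain ⟨M, hM, hsum⟩ := slow_sum' hanti hpos h1 hL
  have hg : ∀ N : ℕ, ∑ k ∈ Finset.range (N + 1), P.real {ω | (k:ℝ) ≤ T ω} ≤
      2 + ∑ k ∈ Finset.range N, L (k + 1) := by
    intro N
    rw [Finset.sum_range_succ']
    have g0 : P.real {ω | ((0:ℕ):ℝ) ≤ T ω} ≤ 1 := measureReal_le_one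
    cases N with
    | zero =>
      rw [Finset.sum_range_zero, Finset.sum_range_zero]; linarith
    | succ N =>
      rw [Finset.sum_range_succ', Finset.sum_range_succ _ N]
      have g1 : P.real {ω | ((0 + 1 : ℕ):ℝ) ≤ T ω} ≤ 1 := measureReal_le_one
      have g2 := hpos ((N:ℝ) + 1) (by positivity)
      have g3 : ∑ k ∈ Finset.range N, P.real {ω | ((k + 1 + 1 : ℕ):ℝ) ≤ T ω} ≤
          ∑ k ∈ Finset.range N, L (k + 1) := by
        refine Finset.sum_le_sum fun k _ => ?_
        rw [← htail' _ (by positivity)]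
        refine measureReal_mono fun ω hω => ?_
        simp only [mem_ofPred_eq] at hω ⊢
        push_cast at hω
        linarith
      linarith
  have hms := mscale_tendsto hα
  have hratio : ∀ c : ℝ, 0 < c →
      Tendsto (fun u => L (c * mscale α u) / L (mscale α u)) atTop (𝓝 1) :=
    fun c hc => (hL c hc).comp hms
  change Tendsto (fun u => P.real {ω | u < sSup ((fun s => X s ω) '' Icc 0 (T ω))} /
    L (mscale α u)) atTop (𝓝 1)
  refine tendsto_order.2 ⟨fun b hb => ?_, fun b hb => ?_⟩
  · obtain ⟨A, hA, hlow⟩ := hG.lower_main hr0 hcont hα hC hδ hloc hA2 hA3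
      (show 0 < (1 - b) / 2 by linarith)
    have hl := (hratio A hA).mul_const (1 - (1 - b) / 2)
    filter_upwards [hlow, eventually_gt_atTop 0,
      hl.eventually (lt_mem_nhds (show b < 1 * (1 - (1 - b) / 2) by linarith))] with u hu hu0 hub
    obtain ⟨n, q, hq, hnq, hP⟩ := hu
    have hm := mscale_pos (α := α) hu0
    have hb1 := lower_bound hcont hindep hq hnq hP
    rw [htail' _ (by positivity)] at hb1
    have hLm := hpos _ hm
    refine hub.trans_le ?_
    rw [div_mul_eq_mul_div]
    gcongr
  · set a := (b - 1) / (2 * (K * M)) with ha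
    have ha0 : 0 < a := div_pos (by linarith) (by positivity)
    have hKMa : K * M * a = (b - 1) / 2 := by rw [ha]; field_simp
    have hl := (hratio a ha0).add ((hratio (a / 2) (by linarith)).const_mul (K * M * a))
    filter_upwards [hunit, eventually_gt_atTop 0, (hms.const_mul_atTop ha0).eventually_ge_atTop 2,
      hl.eventually (gt_mem_nhds (show 1 + K * M * a * 1 < b by rw [hKMa]; linarith))] with
      u hu hu0 hu2 hub
    have hm := mscale_pos (α := α) hu0
    have hLm := hpos _ hm
    have hb1 := upper_bound hcont hT0 hindep (u := u) (κ := K / mscale α u) (b := a * mscale α u)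
      (by positivity) (by positivity) hu
    rw [htail' _ (by positivity)] at hb1
    have h2 := (hg ⌊a * mscale α u⌋₊).trans (hsum _ hu2)
    have h3 : K / mscale α u * ∑ k ∈ Finset.range (⌊a * mscale α u⌋₊ + 1), P.real {ω | (k:ℝ) ≤ T ω}
        ≤ K / mscale α u * (M * (a * mscale α u) * L (a * mscale α u / 2)) := by gcongr
    have h4 : K / mscale α u * (M * (a * mscale α u) * L (a * mscale α u / 2)) =
        K * M * a * L (a / 2 * mscale α u) := by
      have : a * mscale α u / 2 = a / 2 * mscale α u := by ring
      rw [this]; field_simp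
    refine lt_of_le_of_lt ?_ hub
    rw [← mul_div_assoc, ← add_div]
    gcongr
    linarith
end

section
/- Let ε, a, A_∞ > 0 and set q(u) = a u^{−2/α}. Under assumptions (A1) and (A3), (A_∞ m(u)/q(u)) · Σ_{k : ε ≤ k q(u) ≤ A_∞ m(u)} |r(k q(u))| · exp(−u² / (1 + |r(k q(u))|)) → 0 as u → ∞. -/
open MeasureTheory ProbabilityTheory Filter Set Topology

lemma gauss_memLp {Ω : Type*} [MeasurableSpace Ω] {P : Measure Ω} {Y : Ω → ℝ} {v : NNReal}
    (h : Measure.map Y P = gaussianReal 0 v) : AEMeasurable Y P ∧ MemLp Y 2 P ∧ ∫ ω, Y ω ^ 2 ∂P = v := by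
  have hm : AEMeasurable Y P := by
    apply AEMeasurable.of_map_ne_zero
    rw [h]; exact NeZero.ne _
  refine ⟨hm, ?_, ?_⟩
  · have := memLp_id_gaussianReal (μ := 0) (v := v) 2
    rw [← h] at this
    have h2 := (memLp_map_measure_iff (by fun_prop) hm).1 this
    simpa using h2
  · have h1 : ∫ ω, Y ω ^ 2 ∂P = ∫ x, x ^ 2 ∂(Measure.map Y P) :=
      (integral_map hm (f := fun x : ℝ => x ^ 2) (by fun_prop)).symm
    rw [h1, h]
    have h3 := variance_id_gaussianReal (μ := 0) (v := v)
    rw [variance_eq_integral (by fun_prop)] at h3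
    simpa using h3

lemma r_tendsto {r : ℝ → ℝ} {C α : ℝ} (hα : 0 < α)
    (hA1 : (fun t => r t - (1 - C * |t| ^ α)) =o[𝓝[>] (0:ℝ)] fun t => |t| ^ α) :
    Tendsto r (𝓝[>] 0) (𝓝 1) := by
  have h0 : Tendsto (fun t : ℝ => |t| ^ α) (𝓝[>] 0) (𝓝 0) := by
    have : ContinuousAt (fun t : ℝ => |t| ^ α) 0 := by
      apply ContinuousAt.rpow_const
      · fun_prop
      · right; exact hα.le
    have h := this.tendsto
    simp only [abs_zero, Real.zero_rpow hα.ne'] at h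
    exact h.mono_left nhdsWithin_le_nhds
  have h1 := hA1.trans_tendsto h0
  have h2 := h1.add ((tendsto_const_nhds (x := (1:ℝ))).sub (h0.const_mul C))
  simpa using h2

lemma r0_pos {Ω : Type*} [MeasurableSpace Ω] {P : Measure Ω} [IsProbabilityMeasure P]
    {X : ℝ → Ω → ℝ} {r : ℝ → ℝ}
    (hGauss : ∀ (n : ℕ) (c : Fin n → ℝ) (t : Fin n → ℝ), (∀ i, 0 ≤ t i) →
      Measure.map (fun ω => ∑ i, c i * X (t i) ω) P
        = gaussianReal 0 (Real.toNNReal (∑ i, ∑ j, c i * c j * r (|t i - t j|))))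
    (hr : Tendsto r (𝓝[>] 0) (𝓝 1)) : 0 < r 0 := by
  by_contra hneg
  push Not at hneg
  have hX : ∀ t, 0 ≤ t → X t =ᵐ[P] 0 := by
    intro t ht
    have h := hGauss 1 (fun _ => 1) (fun _ => t) (fun _ => ht)
    simp only [Finset.univ_unique, Finset.sum_singleton, one_mul, sub_self, abs_zero] at h
    rw [Real.toNNReal_of_nonpos hneg] at h
    obtain ⟨hm, hL, hI⟩ := gauss_memLp h
    have h2 : (fun ω => X t ω ^ 2) =ᵐ[P] 0 := by
      rw [← integral_eq_zero_iff_of_nonneg (fun ω => sq_nonneg _) hL.integrable_sq]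
      simpa using hI
    filter_upwards [h2] with ω hω
    simpa using hω
  have hev : ∀ᶠ t in 𝓝[>] (0:ℝ), 1/2 < r t := hr.eventually (lt_mem_nhds (by norm_num))
  obtain ⟨d, hd, hd2⟩ := mem_nhdsGT_iff_exists_Ioo_subset.1 hev
  have hd : 0 < d := hd
  obtain ⟨n, hn⟩ := exists_nat_gt (1 - 2 * r 0)
  have hn0 : (0:ℝ) < n := by linarith
  have ht : ∀ i : Fin n, 0 ≤ (i : ℝ) / n * d := fun i => by positivity
  have h := hGauss n (fun _ => 1) (fun i => (i : ℝ) / n * d) ht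
  obtain ⟨hm, hL, hI⟩ := gauss_memLp h
  have hz : (fun ω => ∑ i : Fin n, 1 * X ((i:ℝ) / n * d) ω) =ᵐ[P] 0 := by
    have : ∀ᵐ ω ∂P, ∀ i : Fin n, X ((i:ℝ) / n * d) ω = 0 :=
      ae_all_iff.2 fun i => hX _ (ht i)
    filter_upwards [this] with ω hω
    simp [hω]
  have hI0 : ∫ ω, (∑ i : Fin n, 1 * X ((i:ℝ) / n * d) ω)^2 ∂P = 0 := by
    apply integral_eq_zero_of_ae
    filter_upwards [hz] with ω hω
    simp only [Pi.zero_apply] at hω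
    simp only [hω, Pi.zero_apply]; norm_num
  rw [hI0] at hI
  have hform := Real.toNNReal_eq_zero.1 (NNReal.coe_eq_zero.1 hI.symm)
  have hge : ∑ i : Fin n, ∑ j : Fin n, (1/2 + (if i = j then r 0 - 1/2 else 0)) ≤
      ∑ i : Fin n, ∑ j : Fin n, 1 * 1 * r (|(i : ℝ) / n * d - (j : ℝ) / n * d|) := by
    refine Finset.sum_le_sum fun i _ => Finset.sum_le_sum fun j _ => ?_
    by_cases hij : i = j
    · subst hij; simp
    · rw [if_neg hij, one_mul, one_mul, add_zero]
      apply le_of_lt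
      apply hd2
      have hij' : (i : ℝ) ≠ (j : ℝ) := by
        intro hh; apply hij; apply Fin.ext; exact_mod_cast hh
      have e : |(i : ℝ) / n * d - (j : ℝ) / n * d| = |(i:ℝ) - j| / n * d := by
        rw [show (i : ℝ) / n * d - (j : ℝ) / n * d = ((i:ℝ) - j) / n * d by ring, abs_mul, abs_div,
          abs_of_pos hn0, abs_of_pos hd]
      have hp : 0 < |(i:ℝ) - j| := abs_pos.2 (sub_ne_zero.2 hij')
      have hl : |(i:ℝ) - j| < n := by
        have h1 : (i:ℝ) < n := by exact_mod_cast i.2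
        have h2 : (j:ℝ) < n := by exact_mod_cast j.2
        have h3 : (0:ℝ) ≤ i := by positivity
        have h4 : (0:ℝ) ≤ j := by positivity
        rw [abs_lt]; constructor <;> linarith
      rw [e]
      constructor
      · positivity
      · have : |(i:ℝ) - j| / n < 1 := by rw [div_lt_one hn0]; exact hl
        nlinarith
  have hs : ∑ i : Fin n, ∑ j : Fin n, ((1:ℝ)/2 + (if i = j then r 0 - 1/2 else 0))
      = n * (n / 2 + (r 0 - 1/2)) := by
    simp [Finset.sum_add_distrib]; ring
  rw [hs] at hge
  have : (0:ℝ) < n * (n / 2 + (r 0 - 1/2)) := mul_pos hn0 (by linarith)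
  linarith

lemma two_point {Ω : Type*} [MeasurableSpace Ω] {P : Measure Ω} [IsProbabilityMeasure P]
    {X : ℝ → Ω → ℝ} {r : ℝ → ℝ}
    (hGauss : ∀ (n : ℕ) (c : Fin n → ℝ) (t : Fin n → ℝ), (∀ i, 0 ≤ t i) →
      Measure.map (fun ω => ∑ i, c i * X (t i) ω) P
        = gaussianReal 0 (Real.toNNReal (∑ i, ∑ j, c i * c j * r (|t i - t j|))))
    (s t : ℝ) (hs : 0 ≤ s) (ht : 0 ≤ t) (σ : ℝ) (hσ : σ ^ 2 = 1) :
    Measure.map (fun ω => X s ω + σ * X t ω) P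
      = gaussianReal 0 (Real.toNNReal (2 * r 0 + 2 * σ * r |s - t|)) := by
  have h := hGauss 2 ![1, σ] ![s, t] (by intro i; fin_cases i <;> simpa)
  simp only [Fin.sum_univ_two, Matrix.cons_val_zero, Matrix.cons_val_one, one_mul, sub_self,
    abs_zero, mul_one] at h
  rw [h, abs_sub_comm t s]
  congr 2
  linear_combination r 0 * hσ

lemma cov_eq {Ω : Type*} [MeasurableSpace Ω] {P : Measure Ω} [IsProbabilityMeasure P]
    {X : ℝ → Ω → ℝ} {r : ℝ → ℝ}
    (hGauss : ∀ (n : ℕ) (c : Fin n → ℝ) (t : Fin n → ℝ), (∀ i, 0 ≤ t i) →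
      Measure.map (fun ω => ∑ i, c i * X (t i) ω) P
        = gaussianReal 0 (Real.toNNReal (∑ i, ∑ j, c i * c j * r (|t i - t j|))))
    (h0 : 0 < r 0) :
    (∀ t, 0 ≤ t → MemLp (X t) 2 P) ∧ 
    ∀ s t, 0 ≤ s → 0 ≤ t → ∫ ω, X s ω * X t ω ∂P = r |s - t| := by
  have hX : ∀ t, 0 ≤ t → MemLp (X t) 2 P ∧ ∫ ω, X t ω ^ 2 ∂P = r 0 := by
    intro t ht
    have h := hGauss 1 (fun _ => 1) (fun _ => t) (fun _ => ht)
    simp only [Finset.univ_unique, Finset.sum_singleton, one_mul, sub_self, abs_zero] at h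
    obtain ⟨hm, hL, hI⟩ := gauss_memLp h
    rw [Real.coe_toNNReal _ h0.le] at hI
    exact ⟨hL, hI⟩
  refine ⟨fun t ht => (hX t ht).1, fun s t hs ht => ?_⟩
  obtain ⟨hLs, hIs⟩ := hX s hs
  obtain ⟨hLt, hIt⟩ := hX t ht
  have key : ∀ σ : ℝ, σ ^ 2 = 1 → 2 * r 0 + 2 * σ * ∫ ω, X s ω * X t ω ∂P
      = max (2 * r 0 + 2 * σ * r |s - t|) 0 := by
    intro σ hσ
    obtain ⟨hm, hL, hI⟩ := gauss_memLp (two_point hGauss s t hs ht σ hσ)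
    rw [Real.coe_toNNReal'] at hI
    rw [← hI]
    have e : (fun ω => (X s ω + σ * X t ω) ^ 2) = fun ω => X s ω ^ 2 + 2 * σ * (X s ω * X t ω)
        + X t ω ^ 2 := by
      ext ω; linear_combination X t ω ^ 2 * hσ
    have i1 := hLs.integrable_sq
    have i2 := hLt.integrable_sq
    have i3 : Integrable (fun ω => X s ω * X t ω) P := hLs.integrable_mul hLt
    rw [e, integral_add (i1.fun_add (i3.const_mul _)) i2, integral_add i1 (i3.const_mul _),
      integral_const_mul, hIs, hIt]
    ring
  have k1 := key 1 (by norm_num)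
  have k2 := key (-1) (by norm_num)
  rcases max_cases (2 * r 0 + 2 * 1 * r |s - t|) 0 with h1 | h1 <;>
  rcases max_cases (2 * r 0 + 2 * (-1) * r |s - t|) 0 with h2 | h2 <;> linarith

lemma r0_eq_one {Ω : Type*} [MeasurableSpace Ω] {P : Measure Ω} [IsProbabilityMeasure P]
    {X : ℝ → Ω → ℝ} {r : ℝ → ℝ}
    (hGauss : ∀ (n : ℕ) (c : Fin n → ℝ) (t : Fin n → ℝ), (∀ i, 0 ≤ t i) →
      Measure.map (fun ω => ∑ i, c i * X (t i) ω) P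
        = gaussianReal 0 (Real.toNNReal (∑ i, ∑ j, c i * c j * r (|t i - t j|))))
    (hcont : ∀ᵐ ω ∂P, ContinuousOn (fun t => X t ω) (Ici 0))
    (hr : Tendsto r (𝓝[>] 0) (𝓝 1)) : r 0 = 1 := by
  have h0 := r0_pos hGauss hr
  obtain ⟨hL, hcov⟩ := cov_eq hGauss h0
  set τ : ℕ → ℝ := fun n => 1 / ((n:ℝ) + 1) with hτ
  have hτpos : ∀ n, 0 < τ n := fun n => by simp only [hτ]; positivity
  have hτ0 : Tendsto τ atTop (𝓝 0) := tendsto_one_div_add_atTop_nhds_zero_nat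
  have hτ1 : Tendsto τ atTop (𝓝[>] 0) :=
    tendsto_nhdsWithin_iff.2 ⟨hτ0, Eventually.of_forall hτpos⟩
  have hmap : ∀ n, Measure.map (fun ω => X 0 ω + (-1) * X (τ n) ω) P
      = gaussianReal 0 (Real.toNNReal (2 * r 0 + 2 * (-1) * r (τ n))) := by
    intro n
    have := two_point hGauss 0 (τ n) le_rfl (hτpos n).le (-1) (by norm_num)
    rwa [zero_sub, abs_neg, abs_of_pos (hτpos n)] at this
  have hlim : Tendsto (fun n => ∫ ω, Real.cos (X 0 ω + (-1) * X (τ n) ω) ∂P) atTop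
      (𝓝 (∫ ω, (1:ℝ) ∂P)) := by
    apply tendsto_integral_of_dominated_convergence (fun _ => 1)
    · intro n
      have hm : AEMeasurable (fun ω => X 0 ω + (-1) * X (τ n) ω) P := (gauss_memLp (hmap n)).1
      exact (Real.measurable_cos.comp_aemeasurable hm).aestronglyMeasurable
    · exact integrable_const _
    · intro n
      exact Eventually.of_forall fun ω => by simpa using Real.abs_cos_le_one _
    · filter_upwards [hcont] with ω hω
      have h1 : Tendsto (fun n => X (τ n) ω) atTop (𝓝 (X 0 ω)) := by
        have := (hω 0 (by simp)).tendsto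
        refine this.comp (tendsto_nhdsWithin_iff.2 ⟨hτ0, Eventually.of_forall fun n => (hτpos n).le⟩)
      have h2 := (Real.continuous_cos.tendsto _).comp
        ((tendsto_const_nhds (x := X 0 ω)).add (h1.const_mul (-1)))
      simpa [Function.comp_def] using h2
  have hval : ∀ n, ∫ ω, Real.cos (X 0 ω + (-1) * X (τ n) ω) ∂P =
      Real.exp (-(max (2 * r 0 + 2 * (-1) * r (τ n)) 0) / 2) := by
    intro n
    have hm : AEMeasurable (fun ω => X 0 ω + (-1) * X (τ n) ω) P := (gauss_memLp (hmap n)).1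
    have e1 : ∫ ω, Real.cos (X 0 ω + (-1) * X (τ n) ω) ∂P
        = ∫ x, Real.cos x ∂(Measure.map (fun ω => X 0 ω + (-1) * X (τ n) ω) P) :=
      (integral_map hm (f := Real.cos) (by fun_prop)).symm
    rw [e1, hmap n]
    set v := Real.toNNReal (2 * r 0 + 2 * (-1) * r (τ n)) with hv
    have hc := charFun_gaussianReal (μ := 0) (v := v) 1
    rw [charFun_apply_real] at hc
    have hre := congrArg Complex.re hc
    rw [← RCLike.re_eq_complex_re, ← integral_re] at hre
    · have e2 : ∀ x : ℝ, RCLike.re (Complex.exp (((1:ℝ):ℂ) * x * Complex.I)) = Real.cos x := by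
        intro x
        rw [RCLike.re_eq_complex_re]
        simp [Complex.exp_ofReal_mul_I_re]
      simp only [e2] at hre
      rw [hre, ← Real.coe_toNNReal', ← hv, RCLike.re_eq_complex_re, ← Complex.exp_ofReal_re]
      congr 2
      push_cast
      ring
    · apply Integrable.of_bound (C := 1)
      · exact Continuous.aestronglyMeasurable (by fun_prop)
      · refine Eventually.of_forall fun x => ?_
        simp [Complex.norm_exp]
  have hlim2 : Tendsto (fun n => Real.exp (-(max (2 * r 0 + 2 * (-1) * r (τ n)) 0) / 2)) atTop
      (𝓝 (Real.exp (-(max (2 * r 0 + 2 * (-1) * 1) 0) / 2))) := by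
    have hrt : Tendsto (fun n => r (τ n)) atTop (𝓝 1) := hr.comp hτ1
    apply (Real.continuous_exp.tendsto _).comp
    exact ((((hrt.const_mul _).const_add _).max tendsto_const_nhds).neg).div_const 2
  simp only [hval] at hlim
  have heq := tendsto_nhds_unique hlim hlim2
  simp only [integral_const, probReal_univ, smul_eq_mul, mul_one] at heq
  have h5 := (Real.exp_eq_one_iff _).1 heq.symm
  have hle : r 0 ≤ 1 := by
    by_contra hgt
    push Not at hgt
    rw [max_eq_left (by linarith)] at h5
    linarith
  -- the reverse inequality from Cauchy-Schwarz
  have hge : ∀ t, 0 ≤ t → r t ≤ r 0 := by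
    intro t ht
    have i1 := (hL 0 le_rfl).integrable_sq
    have i2 := (hL t ht).integrable_sq
    have i3 : Integrable (fun ω => X 0 ω * X t ω) P := (hL 0 le_rfl).integrable_mul (hL t ht)
    have c1 := hcov 0 0 le_rfl le_rfl
    have c2 := hcov t t ht ht
    have c3 := hcov 0 t le_rfl ht
    rw [zero_sub, abs_neg, abs_of_nonneg ht] at c3
    simp only [sub_self, abs_zero] at c1 c2
    have := integral_mono (μ := P) i3 ((i1.add i2).div_const 2) (fun ω => by
      simp only [Pi.add_apply]; nlinarith [sq_nonneg (X 0 ω - X t ω)])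
    simp only [Pi.add_apply] at this
    rw [integral_div, integral_add i1 i2] at this
    simp only [sq] at this
    linarith
  have : 1 ≤ r 0 := le_of_tendsto hr (by
    filter_upwards [self_mem_nhdsWithin] with t ht using hge t (le_of_lt ht))
  linarith

lemma key_ineq {Ω : Type*} [MeasurableSpace Ω] {P : Measure Ω} [IsProbabilityMeasure P]
    {X : ℝ → Ω → ℝ} {r : ℝ → ℝ} (h0 : r 0 = 1)
    (hL : ∀ t, 0 ≤ t → MemLp (X t) 2 P)
    (hcov : ∀ s t, 0 ≤ s → 0 ≤ t → ∫ ω, X s ω * X t ω ∂P = r |s - t|)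
    (s t : ℝ) (hs : 0 ≤ s) (ht : 0 ≤ t) (σ : ℝ) (hσ : σ ^ 2 = 1) :
    (r s - σ * r t) ^ 2 ≤ 2 * (1 - σ * r |s - t|) := by
  set x : ℝ := -(r s - σ * r t) with hx
  have M : ∀ a b, 0 ≤ a → 0 ≤ b → Integrable (fun ω => X a ω * X b ω) P :=
    fun a b ha hb => (hL a ha).integrable_mul (hL b hb)
  have z : (0:ℝ) ≤ 0 := le_rfl
  have hpos : 0 ≤ ∫ ω, (x * X 0 ω + X s ω - σ * X t ω) ^ 2 ∂P := integral_nonneg fun _ => sq_nonneg _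
  have e : (fun ω => (x * X 0 ω + X s ω - σ * X t ω) ^ 2) = fun ω =>
      x ^ 2 * (X 0 ω * X 0 ω) + X s ω * X s ω + X t ω * X t ω + 2 * x * (X 0 ω * X s ω)
      + (-2 * x * σ) * (X 0 ω * X t ω) + (-2 * σ) * (X s ω * X t ω) := by
    ext ω; linear_combination X t ω ^ 2 * hσ
  have j1 := (M 0 0 z z).const_mul (x ^ 2)
  have j2 := j1.fun_add (M s s hs hs)
  have j3 := j2.fun_add (M t t ht ht)
  have j4 := j3.fun_add ((M 0 s z hs).const_mul (2 * x))
  have j5 := j4.fun_add ((M 0 t z ht).const_mul (-2 * x * σ))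
  rw [e, integral_add j5 ((M s t hs ht).const_mul _),
    integral_add j4 ((M 0 t z ht).const_mul _), integral_add j3 ((M 0 s z hs).const_mul _),
    integral_add j2 (M t t ht ht), integral_add j1 (M s s hs hs)] at hpos
  simp only [integral_const_mul] at hpos
  rw [hcov _ _ z z, hcov _ _ hs hs, hcov _ _ ht ht, hcov _ _ z hs, hcov _ _ z ht,
    hcov _ _ hs ht] at hpos
  simp only [sub_self, abs_zero, zero_sub, abs_neg, abs_of_nonneg hs, abs_of_nonneg ht, h0] at hpos
  rw [hx] at hpos
  nlinarith

lemma exists_delta {r : ℝ → ℝ} (h0 : r 0 = 1)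
    (hkey : ∀ s t, 0 ≤ s → 0 ≤ t → ∀ σ : ℝ, σ ^ 2 = 1 →
      (r s - σ * r t) ^ 2 ≤ 2 * (1 - σ * r |s - t|))
    (hr : Tendsto r (𝓝[>] 0) (𝓝 1)) (hA3 : Tendsto (fun t => r t * Real.log t) atTop (𝓝 0))
    (ε : ℝ) (hε : 0 < ε) : ∃ δ, 0 ≤ δ ∧ δ < 1 ∧ ∀ t, ε ≤ t → |r t| ≤ δ := by
  have hinf : Tendsto r atTop (𝓝 0) := by
    have := hA3.mul Real.tendsto_log_atTop.inv_tendsto_atTop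
    rw [mul_zero] at this
    refine this.congr' ?_
    filter_upwards [eventually_gt_atTop 1] with t ht
    have : Real.log t ≠ 0 := (Real.log_pos ht).ne'
    simp [this]
  have hle : ∀ t, 0 ≤ t → |r t| ≤ 1 := by
    intro t ht
    have h1 := hkey t 0 ht le_rfl 1 (by norm_num)
    have h2 := hkey t 0 ht le_rfl (-1) (by norm_num)
    rw [sub_zero, abs_of_nonneg ht] at h1 h2
    rw [abs_le]; constructor <;> nlinarith
  have hlt : ∀ t, 0 < t → |r t| < 1 := by
    intro t ht
    refine lt_of_le_of_ne (hle t ht.le) fun hcon => ?_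
    have hsq : r t ^ 2 = 1 := by rw [← sq_abs, hcon]; norm_num
    have hstep : ∀ s, 0 ≤ s → |r (s + t)| = |r s| := by
      intro s hs
      have h1 := hkey (s + t) s (by linarith) hs (r t) hsq
      rw [add_sub_cancel_left, abs_of_pos ht] at h1
      have h2 : r (s + t) - r t * r s = 0 := by
        apply pow_eq_zero_iff (two_ne_zero) |>.1
        nlinarith [sq_nonneg (r (s + t) - r t * r s)]
      rw [sub_eq_zero.1 h2, abs_mul, hcon, one_mul]
    have hn : ∀ n : ℕ, |r (n * t)| = 1 := by
      intro n
      induction n with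
      | zero => simp [h0]
      | succ k ih => 
        push_cast
        rw [add_mul, one_mul, hstep _ (by positivity), ih]
    have h3 : Tendsto (fun n : ℕ => |r (n * t)|) atTop (𝓝 |0|) :=
      (hinf.comp (tendsto_natCast_atTop_atTop.atTop_mul_const ht)).abs
    simp only [hn, abs_zero] at h3
    exact one_ne_zero (tendsto_nhds_unique tendsto_const_nhds h3)
  obtain ⟨T, hT⟩ := eventually_atTop.1 ((hinf.abs).eventually (gt_mem_nhds
    (show |(0:ℝ)| < 1/2 by norm_num)))
  have hcont : ContinuousOn r (Icc ε (max ε T)) := by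
    intro t ht
    have ht0 : 0 ≤ t := hε.le.trans ht.1
    have hlim : Tendsto (fun s => Real.sqrt (2 * (1 - 1 * r |s - t|))) (𝓝 t) (𝓝 0) := by
      have h1 : Tendsto r (𝓝[≥] 0) (𝓝 1) := by
        rw [← Ioi_insert, nhdsWithin_insert]
        refine Tendsto.sup ?_ hr
        rw [← h0]; exact tendsto_pure_nhds _ _
      have h2 : Tendsto (fun s => |s - t|) (𝓝 t) (𝓝[≥] 0) := by
        refine tendsto_nhdsWithin_iff.2 ⟨?_, Eventually.of_forall fun s => mem_Ici.2 (abs_nonneg _)⟩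
        have : Continuous fun s : ℝ => |s - t| := by fun_prop
        simpa using this.tendsto t
      have h3 := h1.comp h2
      have h4 := (((h3.const_mul 1).const_sub 1).const_mul 2).sqrt
      simpa using h4
    rw [ContinuousWithinAt, tendsto_iff_dist_tendsto_zero]
    refine squeeze_zero' (Eventually.of_forall fun _ => dist_nonneg) ?_
      (hlim.mono_left nhdsWithin_le_nhds)
    filter_upwards [self_mem_nhdsWithin] with s hs
    have h1 := hkey s t (hε.le.trans hs.1) ht0 1 (by norm_num)
    rw [Real.dist_eq]
    apply Real.le_sqrt_of_sq_le
    rw [sq_abs]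
    simpa using h1
  obtain ⟨x, hx, hmax⟩ := isCompact_Icc.exists_isMaxOn ⟨ε, left_mem_Icc.2 (le_max_left _ _)⟩ hcont.abs
  refine ⟨max |r x| (1/2), le_max_of_le_left (abs_nonneg _), 
    max_lt (hlt x (hε.trans_le hx.1)) (by norm_num), fun t ht => ?_⟩
  by_cases h : t ≤ max ε T
  · exact le_max_of_le_left (hmax ⟨ht, h⟩)
  · push Not at h
    exact le_max_of_le_right (hT t ((le_max_right _ _).trans h.le)).le

lemma tail_lower : ∃ c : ℝ, 0 < c ∧ ∀ u : ℝ, 1 ≤ u →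
    c * (u⁻¹ * Real.exp (-(u ^ 2 / 2))) ≤ ((gaussianReal 0 1) (Ioi u)).toReal := by
  refine ⟨(√(2 * Real.pi))⁻¹ * Real.exp (-(3 / 2)), by positivity, fun u hu => ?_⟩
  have hu0 : 0 < u := by linarith
  have hnn : ∀ x, 0 ≤ gaussianPDFReal 0 1 x := fun x => gaussianPDFReal_nonneg 0 1 x
  rw [gaussianReal_apply_eq_integral _ one_ne_zero,
    ENNReal.toReal_ofReal (integral_nonneg fun x => hnn x)]
  have hint := integrable_gaussianPDFReal 0 1
  have h1 : ∫ x in Ioc u (u + u⁻¹), gaussianPDFReal 0 1 x ≤ ∫ x in Ioi u, gaussianPDFReal 0 1 x :=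
    setIntegral_mono_set hint.integrableOn (Eventually.of_forall fun x => hnn x)
      (Eventually.of_forall fun x hx => hx.1)
  have h2 := setIntegral_ge_of_const_le_real (μ := volume) (s := Ioc u (u + u⁻¹))
    (f := gaussianPDFReal 0 1)
    (c := (√(2 * Real.pi))⁻¹ * Real.exp (-(3 / 2)) * Real.exp (-(u ^ 2 / 2)))
    measurableSet_Ioc (by simp) (fun x hx => by
      rw [gaussianPDFReal_def, mul_assoc, ← Real.exp_add]
      simp only [NNReal.coe_one, mul_one, sub_zero]
      gcongr
      have hx1 : u < x := hx.1
      have hx0 : 0 ≤ x := hu0.le.trans hx1.le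
      have hx2 : x ≤ u + u⁻¹ := hx.2
      have hi : u⁻¹ ≤ 1 := inv_le_one_of_one_le₀ hu
      have hi0 : 0 < u⁻¹ := by positivity
      have huu : u * u⁻¹ = 1 := mul_inv_cancel₀ hu0.ne'
      have : x ^ 2 ≤ (u + u⁻¹) ^ 2 := by gcongr
      nlinarith) hint.integrableOn
  have h3 : volume.real (Ioc u (u + u⁻¹)) = u⁻¹ := by
    rw [Real.volume_real_Ioc_of_le (by have : 0 < u⁻¹ := by positivity
                                       linarith)]
    ring
  rw [h3] at h2
  calc _ = (√(2 * Real.pi))⁻¹ * Real.exp (-(3 / 2)) * Real.exp (-(u ^ 2 / 2)) * u⁻¹ := by ring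
    _ ≤ _ := h2.trans h1

lemma sum_ite_le (n : ℕ) (x c : ℝ) (hx : 0 ≤ x) (hc : 0 ≤ c) :
    ∑ k ∈ Finset.range n, (if 1 ≤ k ∧ (k : ℝ) ≤ x then c else 0) ≤ x * c := by
  rw [← Finset.sum_filter, Finset.sum_const, nsmul_eq_mul]
  gcongr
  have hsub : (Finset.range n).filter (fun k : ℕ => 1 ≤ k ∧ (k : ℝ) ≤ x) ⊆ Finset.Icc 1 ⌊x⌋₊ := by
    intro k hk
    rw [Finset.mem_filter] at hk
    exact Finset.mem_Icc.2 ⟨hk.2.1, Nat.le_floor hk.2.2⟩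
  have h1 := Finset.card_le_card hsub
  rw [Nat.card_Icc, Nat.add_sub_cancel] at h1
  calc _ ≤ ((⌊x⌋₊ : ℕ) : ℝ) := by exact_mod_cast h1
    _ ≤ x := Nat.floor_le hx

lemma tsum_split_le (f : ℕ → ℝ) (x c y d : ℝ) (hx : 0 ≤ x) (hc : 0 ≤ c) (hy : 0 ≤ y) (hd : 0 ≤ d)
    (hf : ∀ k, 0 ≤ f k)
    (h : ∀ k : ℕ, f k ≤ (if 1 ≤ k ∧ (k : ℝ) ≤ x then c else 0) +
      (if 1 ≤ k ∧ (k : ℝ) ≤ y then d else 0)) : ∑' k, f k ≤ x * c + y * d := by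
  apply Real.tsum_le_of_sum_range_le hf
  intro n
  calc _ ≤ ∑ k ∈ Finset.range n, ((if 1 ≤ k ∧ (k : ℝ) ≤ x then c else 0) +
      (if 1 ≤ k ∧ (k : ℝ) ≤ y then d else 0)) := Finset.sum_le_sum fun k _ => h k
    _ ≤ _ := by
      rw [Finset.sum_add_distrib]
      exact add_le_add (sum_ite_le n x c hx hc) (sum_ite_le n y d hy hd)

/-- the pure estimate for one fixed (large) `u` -/
lemma fixed_u (r : ℝ → ℝ) (u q M ε δ γ η : ℝ) (hq : 0 < q) (hε : 0 < ε) (hδ0 : 0 ≤ δ) (hδ1 : δ < 1)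
    (hδ : ∀ t, ε ≤ t → |r t| ≤ δ) (hγ : 0 < γ) (hη : 0 < η) (hu : 0 < u) (hM : 0 ≤ M)
    (hfar : ∀ t, Real.exp (γ * u ^ 2) < t → |r t| * Real.log t ≤ η) :
    ∑' k : ℕ, (if ε ≤ (k : ℝ) * q ∧ (k : ℝ) * q ≤ M then
        |r ((k : ℝ) * q)| * Real.exp (-(u^2 / (1 + |r ((k : ℝ) * q)|))) else 0)
      ≤ (Real.exp (γ * u ^ 2) / q) * Real.exp (-(u ^ 2 / (1 + δ)))
        + (M / q) * ((η / (γ * u ^ 2)) * Real.exp (-u ^ 2 + η / γ)) := by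
  apply tsum_split_le
  · positivity
  · positivity
  · positivity
  · positivity
  · intro k; split_ifs <;> positivity
  intro k
  by_cases hk : ε ≤ (k : ℝ) * q ∧ (k : ℝ) * q ≤ M
  swap
  · rw [if_neg hk]; split_ifs <;> positivity
  rw [if_pos hk]
  have hk1 : 1 ≤ k := by
    rcases Nat.eq_zero_or_pos k with h | h
    · exfalso
      have := hk.1
      rw [h] at this; simp at this; linarith
    · exact h
  set t := (k : ℝ) * q with ht
  have hr := hδ t hk.1
  have hr0 := abs_nonneg (r t)
  by_cases hT : t ≤ Real.exp (γ * u ^ 2)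
  · rw [if_pos (⟨hk1, by rw [le_div_iff₀ hq]; exact hT⟩ : 1 ≤ k ∧ (k : ℝ) ≤ Real.exp (γ * u ^ 2) / q)]
    have h1 : |r t| * Real.exp (-(u^2 / (1 + |r t|))) ≤ Real.exp (-(u ^ 2 / (1 + δ))) := by
      calc _ ≤ 1 * Real.exp (-(u ^ 2 / (1 + δ))) := by
            gcongr
            linarith
        _ = _ := one_mul _
    have h2 : 0 ≤ (if 1 ≤ k ∧ (k : ℝ) ≤ M / q then
      (η / (γ * u ^ 2)) * Real.exp (-u ^ 2 + η / γ) else 0) := by split_ifs <;> positivity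
    linarith
  · push Not at hT
    rw [if_pos (⟨hk1, by rw [le_div_iff₀ hq]; exact hk.2⟩ : 1 ≤ k ∧ (k : ℝ) ≤ M / q)]
    have hlog : γ * u ^ 2 ≤ Real.log t := by
      rw [Real.le_log_iff_exp_le ((Real.exp_pos _).trans hT)]; exact hT.le
    have hru : |r t| * (γ * u ^ 2) ≤ η := 
      (mul_le_mul_of_nonneg_left hlog hr0).trans (hfar t hT)
    have hr1 : |r t| ≤ η / (γ * u ^ 2) := by
      rw [le_div_iff₀ (by positivity)]; exact hru
    have hr2 : u ^ 2 * |r t| ≤ η / γ := by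
      rw [le_div_iff₀ hγ]; linarith
    have hexp : -(u ^ 2 / (1 + |r t|)) ≤ -u ^ 2 + η / γ := by
      have : u ^ 2 * (1 - |r t|) ≤ u ^ 2 / (1 + |r t|) := by
        rw [le_div_iff₀ (by positivity)]
        nlinarith [mul_nonneg (sq_nonneg u) (sq_nonneg (|r t|))]
      nlinarith
    have h1 : |r t| * Real.exp (-(u^2 / (1 + |r t|))) ≤
        (η / (γ * u ^ 2)) * Real.exp (-u ^ 2 + η / γ) := by
      gcongr
    have h2 : 0 ≤ (if 1 ≤ k ∧ (k : ℝ) ≤ Real.exp (γ * u ^ 2) / q then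
      Real.exp (-(u ^ 2 / (1 + δ))) else 0) := by split_ifs <;> positivity
    linarith

lemma analytic (r : ℝ → ℝ) (α : ℝ) (m q : ℝ → ℝ) (ε a A D δ : ℝ) (hα : 0 < α)
    (hε : 0 < ε) (ha : 0 < a) (hA : 0 < A) (hD : 0 < D) (hδ0 : 0 ≤ δ) (hδ1 : δ < 1)
    (hδ : ∀ t, ε ≤ t → |r t| ≤ δ) (hA3 : Tendsto (fun t => r t * Real.log t) atTop (𝓝 0))
    (hm : ∀ u, m u = (D * u ^ (2/α) * ((gaussianReal 0 1) (Ioi u)).toReal)⁻¹)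
    (hq : ∀ u : ℝ, q u = a * u ^ (-(2/α))) :
    Tendsto (fun u => (A * m u / q u) * ∑' k : ℕ,
            (if ε ≤ (k : ℝ) * q u ∧ (k : ℝ) * q u ≤ A * m u then
              |r ((k : ℝ) * q u)| * Real.exp (-(u^2 / (1 + |r ((k : ℝ) * q u)|)))
            else 0)) atTop (𝓝 0) := by
  obtain ⟨c, hc, htail⟩ := tail_lower
  set K : ℝ := A / (D * a * c) with hK
  have hKpos : 0 < K := by positivity
  set γ : ℝ := (1 / (1 + δ) - 1 / 2) / 2 with hγdef
  have hγ : 0 < γ := by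
    have : 1 / 2 < 1 / (1 + δ) := one_div_lt_one_div_of_lt (by linarith) (by linarith)
    simp only [hγdef]; linarith
  set p : ℝ := 2 / α with hp
  have hp0 : 0 < p := by positivity
  -- bound for every η
  have hbound : ∀ η, 0 < η → ∀ᶠ u in atTop, 
      (A * m u / q u) * ∑' k : ℕ,
            (if ε ≤ (k : ℝ) * q u ∧ (k : ℝ) * q u ≤ A * m u then
              |r ((k : ℝ) * q u)| * Real.exp (-(u^2 / (1 + |r ((k : ℝ) * q u)|)))
            else 0) ≤ (K / a) * (u ^ (1 + p) * Real.exp (-γ * u ^ 2)) 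
              + K ^ 2 * ((η / γ) * Real.exp (η / γ)) := by
    intro η hη
    have hev := (hA3.abs).eventually (gt_mem_nhds (show |(0:ℝ)| < η by simpa using hη))
    obtain ⟨T, hT⟩ := eventually_atTop.1 hev
    have hbig : Tendsto (fun u : ℝ => Real.exp (γ * u ^ 2)) atTop atTop :=
      Real.tendsto_exp_atTop.comp ((tendsto_pow_atTop two_ne_zero).const_mul_atTop hγ)
    filter_upwards [hbig.eventually_ge_atTop T, eventually_ge_atTop 1] with u hu1 hu
    have hu0 : 0 < u := by linarith
    have hΨ := htail u hu
    set Ψ := ((gaussianReal 0 1) (Ioi u)).toReal with hΨdef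
    have hΨ0 : 0 < Ψ := lt_of_lt_of_le (by positivity) hΨ
    have hup : 0 < u ^ p := Real.rpow_pos_of_pos hu0 _
    have hqpos : 0 < q u := by rw [hq]; positivity
    have hmpos : 0 < m u := by rw [hm]; positivity
    have hqinv : 1 / q u = u ^ p / a := by
      rw [hq, Real.rpow_neg hu0.le]; field_simp
    have hR : A * m u / q u ≤ K * (u * Real.exp (u ^ 2 / 2)) := by
      have e : A * m u / q u = A / (D * a * Ψ) := by
        rw [hm, hq, Real.rpow_neg hu0.le, ← hΨdef]; field_simp
      rw [e]
      have e2 : K * (u * Real.exp (u ^ 2 / 2)) =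
          A / (D * a * (c * (u⁻¹ * Real.exp (-(u ^ 2 / 2))))) := by
        rw [Real.exp_neg, hK]; field_simp
      rw [e2]
      gcongr
    have hR0 : 0 ≤ A * m u / q u := by positivity
    have hfix := fixed_u r u (q u) (A * m u) ε δ γ η hqpos hε hδ0 hδ1 hδ hγ hη hu0 (by positivity)
      (fun t ht => by
        have h1 := hT t (hu1.trans ht.le)
        have ht1 : 1 ≤ t := (Real.one_le_exp (by positivity)).trans ht.le
        rw [abs_mul, abs_of_nonneg (Real.log_nonneg ht1)] at h1
        exact h1.le)
    set R := A * m u / q u with hRdef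
    set E := u * Real.exp (u ^ 2 / 2) with hE
    have hE0 : 0 < E := by positivity
    calc _ ≤ R * ((Real.exp (γ * u ^ 2) / q u) * Real.exp (-(u ^ 2 / (1 + δ)))
        + R * ((η / (γ * u ^ 2)) * Real.exp (-u ^ 2 + η / γ))) :=
          mul_le_mul_of_nonneg_left hfix hR0
      _ ≤ (K * E) * ((Real.exp (γ * u ^ 2) / q u) * Real.exp (-(u ^ 2 / (1 + δ)))
        + (K * E) * ((η / (γ * u ^ 2)) * Real.exp (-u ^ 2 + η / γ))) := by
          gcongr
      _ = (K / a) * (u ^ (1 + p) * Real.exp (-γ * u ^ 2)) 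
              + K ^ 2 * ((η / γ) * Real.exp (η / γ)) := by
          rw [mul_add]
          congr 1
          · have e1 : Real.exp (-γ * u ^ 2) =
                Real.exp (u ^ 2 / 2) * Real.exp (γ * u ^ 2) * Real.exp (-(u ^ 2 / (1 + δ))) := by
              rw [← Real.exp_add, ← Real.exp_add]
              congr 1
              have : 1 / (1 + δ) = 2 * γ + 1 / 2 := by simp only [hγdef]; ring
              rw [div_eq_mul_one_div (u ^ 2) (1 + δ), this]; ring
            rw [div_eq_mul_one_div _ (q u), hqinv, e1, Real.rpow_add hu0, Real.rpow_one, hE]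
            ring
          · have e1 : Real.exp (-u ^ 2 + η / γ) * (Real.exp (u ^ 2 / 2)) ^ 2 = Real.exp (η / γ) := by
              rw [← Real.exp_nat_mul, ← Real.exp_add]
              congr 1; push_cast; ring
            rw [← e1, hE]
            field_simp
  have hfirst : Tendsto (fun u : ℝ => (K / a) * (u ^ (1 + p) * Real.exp (-γ * u ^ 2))) atTop (𝓝 0) := by
    have h1 := (tendsto_rpow_mul_exp_neg_mul_atTop_nhds_zero ((1 + p) / 2) γ hγ).comp
      (tendsto_pow_atTop (α := ℝ) two_ne_zero)
    have h2 := h1.const_mul (K / a)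
    rw [mul_zero] at h2
    refine h2.congr' ?_
    filter_upwards [eventually_gt_atTop 0] with u hu
    simp only [Function.comp]
    rw [← Real.rpow_natCast u 2, ← Real.rpow_mul hu.le]
    congr 3
    push_cast; ring
  have hsecond : Tendsto (fun η : ℝ => K ^ 2 * ((η / γ) * Real.exp (η / γ))) (𝓝[>] 0) (𝓝 0) := by
    have : Continuous fun η : ℝ => K ^ 2 * ((η / γ) * Real.exp (η / γ)) := by fun_prop
    have h := this.tendsto 0
    simp only [zero_div, zero_mul, mul_zero] at h
    exact h.mono_left nhdsWithin_le_nhds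
  refine tendsto_order.2 ⟨fun b hb => ?_, fun b hb => ?_⟩
  · filter_upwards [eventually_gt_atTop 0] with u hu
    refine hb.trans_le ?_
    have hqpos : 0 < q u := by rw [hq]; positivity
    have hmpos : 0 ≤ m u := by rw [hm]; positivity
    apply mul_nonneg (by positivity)
    apply tsum_nonneg
    intro k
    split_ifs <;> positivity
  · obtain ⟨η, hη, hη0⟩ := ((hsecond.eventually (gt_mem_nhds (half_pos hb))).and
      self_mem_nhdsWithin).exists
    filter_upwards [hbound η hη0, hfirst.eventually (gt_mem_nhds (half_pos hb))] with u h1 h2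
    linarith

/-- **Lemma 4.1.** Let `ε, a, A_∞ > 0` and `q(u) = a u^{-2/α}`. Under (A1) and (A3),
`(A_∞ m(u)/q(u)) Σ_{ε ≤ k q(u) ≤ A_∞ m(u)} |r(k q(u))| exp(-u²/(1+|r(k q(u))|)) → 0`
as `u → ∞`. -/
theorem sum_correlation_negligible
    {Ω : Type*} [MeasurableSpace Ω] (P : Measure Ω) [IsProbabilityMeasure P]
    (X : ℝ → Ω → ℝ) (r : ℝ → ℝ) (C α : ℝ)
    (hα : 0 < α) (hα2 : α ≤ 2) (hC : 0 < C)
    -- centered stationary Gaussian process with covariance function r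
    (hGauss : ∀ (n : ℕ) (c : Fin n → ℝ) (t : Fin n → ℝ), (∀ i, 0 ≤ t i) →
      Measure.map (fun ω => ∑ i, c i * X (t i) ω) P
        = gaussianReal 0 (Real.toNNReal (∑ i, ∑ j, c i * c j * r (|t i - t j|))))
    -- a.s. continuous sample paths
    (hcont : ∀ᵐ ω ∂P, ContinuousOn (fun t => X t ω) (Ici 0))
    -- (A1)
    (hA1 : (fun t => r t - (1 - C * |t| ^ α)) =o[𝓝[>] (0:ℝ)] fun t => |t| ^ α)
    -- (A3)
    (hA3 : Tendsto (fun t => r t * Real.log t) atTop (𝓝 0))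
    -- Pickands constant, defined via a standard fractional Brownian motion `B`
    -- with Hurst parameter `α/2`
    {Ω' : Type*} [MeasurableSpace Ω'] (P' : Measure Ω') [IsProbabilityMeasure P']
    (B : ℝ → Ω' → ℝ)
    (hB : ∀ (n : ℕ) (c : Fin n → ℝ) (t : Fin n → ℝ), (∀ i, 0 ≤ t i) →
      Measure.map (fun ω => ∑ i, c i * B (t i) ω) P'
        = gaussianReal 0 (Real.toNNReal (∑ i, ∑ j,
            c i * c j * ((t i ^ α + t j ^ α - |t i - t j| ^ α) / 2))))
    (HS : ℝ → ℝ)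
    (hHS : ∀ S : ℝ, HS S
      = ∫ ω, Real.exp (sSup ((fun t => Real.sqrt 2 * B t ω - t ^ α) '' Icc 0 S)) ∂P')
    (Hα : ℝ) (hHα : Tendsto (fun S => HS S / S) atTop (𝓝 Hα))
    -- the function m(u) = [C^{1/α} H_α u^{2/α} Ψ(u)]⁻¹
    (m : ℝ → ℝ)
    (hm : ∀ u : ℝ, m u
      = (C ^ (1/α) * Hα * u ^ (2/α) * ((gaussianReal 0 1) (Ioi u)).toReal)⁻¹)
    (ε a Ainf : ℝ) (hε : 0 < ε) (ha : 0 < a) (hAinf : 0 < Ainf)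
    (q : ℝ → ℝ) (hq : ∀ u : ℝ, q u = a * u ^ (-(2/α)))
    :
    Tendsto (fun u =>
        (Ainf * m u / q u) *
          ∑' k : ℕ,
            (if ε ≤ (k : ℝ) * q u ∧ (k : ℝ) * q u ≤ Ainf * m u then
              |r ((k : ℝ) * q u)| * Real.exp (-(u^2 / (1 + |r ((k : ℝ) * q u)|)))
            else 0))
      atTop (𝓝 0) := by
  have hr := r_tendsto hα hA1
  have h0 := r0_eq_one hGauss hcont hr
  obtain ⟨hL, hcov⟩ := cov_eq hGauss (by rw [h0]; exact one_pos)
  obtain ⟨δ, hδ0, hδ1, hδ⟩ := exists_delta h0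
    (fun s t hs ht σ hσ => key_ineq h0 hL hcov s t hs ht σ hσ) hr hA3 ε hε
  by_cases hH : 0 < Hα
  · exact analytic r α m q ε a Ainf (C ^ (1/α) * Hα) δ hα hε ha hAinf (by positivity) hδ0 hδ1 hδ hA3
      hm hq
  · push Not at hH
    refine Tendsto.congr' ?_ tendsto_const_nhds
    filter_upwards [eventually_gt_atTop 0] with u hu
    have hm0 : m u ≤ 0 := by
      rw [hm, inv_nonpos]
      have h1 : 0 ≤ C ^ (1/α) := by positivity
      have h2 : 0 ≤ u ^ (2/α) := by positivity
      exact mul_nonpos_of_nonpos_of_nonneg (mul_nonpos_of_nonpos_of_nonneg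
        (mul_nonpos_of_nonneg_of_nonpos h1 hH) h2) ENNReal.toReal_nonneg
    have hz : ∀ k : ℕ, ¬ (ε ≤ (k : ℝ) * q u ∧ (k : ℝ) * q u ≤ Ainf * m u) := by
      rintro k ⟨h1, h2⟩
      have := mul_nonpos_of_nonneg_of_nonpos hAinf.le hm0
      linarith
    simp only [hz, if_false, tsum_zero, mul_zero]
end
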